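/- arXiv:1807.08022 — 10 statements merged into one kernel-verified Lean document; each statement's English description precedes it below -/
import Mathlib

section
/- Let k ≥ 1 be an integer, let f = f₁/f₂ be a k-th Farey number, and let (x,y) ∈ ℤ². If the lattice triangle S = conv((0,0),(0,1),(x,y)) is contained in the k-th Farey strip F_{k,f} (i.e., every point of S other than the vertex (0,0) lies in F_{k,f}), then S is k-empty. -/
/-- A point of `ℚ²` lies in `k·ℤ²` (a `k`-fold lattice point). -/
def IsKFold (k : ℕ) (p : ℚ × ℚ) : Prop :=
  ∃ m n : ℤ, p = ((((k : ℤ) * m : ℤ) : ℚ), (((k : ℤ) * n : ℤ) : ℚ))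

/-- `(f1, f2)` represents a `k`-th Farey number `f1 / f2`. -/
def IsFareyPair (k : ℕ) (f1 f2 : ℤ) : Prop :=
  0 ≤ f1 ∧ f1 < f2 ∧ f2 ≤ (k : ℤ) ∧ Int.gcd f1 f2 = 1

/-- The `k`-th Farey strip associated to the Farey number `f1 / f2`. -/
def FareyStrip (k : ℕ) (f1 f2 : ℤ) : Set (ℚ × ℚ) :=
  if f2 = (k : ℤ) then
    {p | 0 < -(f1 : ℚ) * p.1 + (f2 : ℚ) * p.2 ∧ -(f1 : ℚ) * p.1 + (f2 : ℚ) * p.2 < (k : ℚ)}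
  else
    {p | 0 < -(f1 : ℚ) * p.1 + (f2 : ℚ) * p.2 ∧ -(f1 : ℚ) * p.1 + (f2 : ℚ) * p.2 ≤ (k : ℚ)}

/-- Barycentric coordinates of a point of a triangle with one vertex at the origin. -/
theorem exists_of_mem_convexHull_zero_triple {u v p : ℚ × ℚ}
    (hp : p ∈ convexHull ℚ ({((0 : ℚ), (0 : ℚ)), u, v} : Set (ℚ × ℚ))) :
    ∃ b c : ℚ, 0 ≤ b ∧ 0 ≤ c ∧ b + c ≤ 1 ∧ p = b • u + c • v := by
  rw [convexHull_insert (by simp), convexHull_pair, segment_eq_image, mem_convexJoin] at hp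
  obtain ⟨o, rfl, q, ⟨t, ⟨ht0, ht1⟩, rfl⟩, a, s, ha, hs, has, rfl⟩ := hp
  refine ⟨s * (1 - t), s * t, mul_nonneg hs (by linarith), mul_nonneg hs ht0, by linarith, ?_⟩
  ext <;> simp <;> ring

/-- If the lattice triangle `conv((0,0), (0,1), (x,y))` is contained in a `k`-th
Farey strip (every point other than the vertex `(0,0)` lies in the strip), then
it is `k`-empty. -/
theorem kempty_of_contained_in_farey_strip (k : ℕ) (hk : 1 ≤ k)
    (f1 f2 : ℤ) (hf : IsFareyPair k f1 f2) (x y : ℤ)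
    (hsub : convexHull ℚ ({((0 : ℚ), (0 : ℚ)), ((0 : ℚ), (1 : ℚ)),
        ((x : ℚ), (y : ℚ))} : Set (ℚ × ℚ)) \ {((0 : ℚ), (0 : ℚ))} ⊆ FareyStrip k f1 f2) :
    ∀ p ∈ convexHull ℚ ({((0 : ℚ), (0 : ℚ)), ((0 : ℚ), (1 : ℚ)),
        ((x : ℚ), (y : ℚ))} : Set (ℚ × ℚ)),
      IsKFold k p →
        p = ((0 : ℚ), (0 : ℚ)) ∨ p = ((0 : ℚ), (1 : ℚ)) ∨ p = ((x : ℚ), (y : ℚ)) := by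
  intro p hp ⟨m, n, hmn⟩
  by_cases hp0 : p = ((0 : ℚ), (0 : ℚ))
  · exact Or.inl hp0
  right; right
  obtain ⟨-, -, hf2k, -⟩ := hf
  have hkpos : (0 : ℚ) < k := by exact_mod_cast hk
  have hpS := hsub ⟨hp, hp0⟩
  have hp1 : p.1 = k * m := by rw [hmn]; push_cast; rfl
  have hp2 : p.2 = k * n := by rw [hmn]; push_cast; rfl
  have hval : -(f1 : ℚ) * p.1 + f2 * p.2 = k * ((-f1 * m + f2 * n : ℤ) : ℚ) := by
    rw [hp1, hp2]; push_cast; ring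
  unfold FareyStrip at hpS hsub
  split_ifs at hpS hsub with h
  · obtain ⟨h0, h1⟩ := hpS
    rw [hval] at h0 h1
    have h0' : 0 < -f1 * m + f2 * n := by exact_mod_cast pos_of_mul_pos_right h0 hkpos.le
    have h1' : ((-f1 * m + f2 * n : ℤ) : ℚ) < 1 := by
      by_contra! hge
      nlinarith
    have : -f1 * m + f2 * n < 1 := by exact_mod_cast h1'
    omega
  · obtain ⟨h0, -⟩ := hpS
    rw [hval] at h0
    have h0' : 1 ≤ -f1 * m + f2 * n := by
      have : 0 < -f1 * m + f2 * n := by exact_mod_cast pos_of_mul_pos_right h0 hkpos.le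
      omega
    have h0'' : (1 : ℚ) ≤ ((-f1 * m + f2 * n : ℤ) : ℚ) := by exact_mod_cast h0'
    have hge : (k : ℚ) ≤ -(f1 : ℚ) * p.1 + f2 * p.2 := by
      rw [hval]; nlinarith
    have hlt : (f2 : ℚ) < k := by exact_mod_cast lt_of_le_of_ne hf2k h
    have hv : -(f1 : ℚ) * x + f2 * y ≤ k := by
      by_cases hxy : ((x : ℚ), (y : ℚ)) = ((0 : ℚ), (0 : ℚ))
      · obtain ⟨hx, hy⟩ := Prod.mk.inj hxy
        rw [hx, hy]; simp
      · exact (hsub ⟨subset_convexHull ℚ _ (by simp), hxy⟩).2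
    obtain ⟨b, c, hb, hc, hbc, rfl⟩ := exists_of_mem_convexHull_zero_triple hp
    simp only [Prod.fst_add, Prod.snd_add, Prod.smul_fst, Prod.smul_snd, smul_eq_mul] at hge
    have hcv := mul_le_mul_of_nonneg_left hv hc
    have hb0 : b = 0 := by
      by_contra hne
      have := mul_lt_mul_of_pos_left hlt (lt_of_le_of_ne hb (Ne.symm hne))
      nlinarith
    subst hb0
    have hc1 : c = 1 := by
      by_contra hne
      have : c < 1 := lt_of_le_of_ne (by linarith) hne
      nlinarith
    simp [hc1]
end

section
/- Let P = conv(0, v₁, …, v_r) ⊆ ℚ² be a full-dimensional ℚ-Gorenstein polytope of index ι ≥ 2, with witnessing linear form α ∈ ℤ² (so ⟨α, vᵢ⟩ = ι for all i = 1,…,r and ι is minimal with this property). If P contains two distinct lattice points, both different from the origin, then P is not canonical; that is, there exists a lattice point p ∈ P ∩ ℤ² with p ≠ 0 and ⟨α, p⟩ ≠ ι. -/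
/-- A point of `ℚ²` is a lattice point if both coordinates are integers. -/
def IsIntPt (p : ℚ × ℚ) : Prop := ∃ m n : ℤ, p = ((m : ℚ), (n : ℚ))

/-- An integral vector killed by a primitive linear form `(a, b)` is an integral multiple of
`(-b, a)`. -/
lemma exists_eq_mul_of_bezout {a b x y m n : ℤ} (hxy : a * x + b * y = 1)
    (h : a * m + b * n = 0) : ∃ k : ℤ, m = -b * k ∧ n = a * k :=
  ⟨x * n - y * m, by linear_combination (-m) * hxy + x * h,
    by linear_combination (-n) * hxy + y * h⟩

/-- A convex set containing the origin and two lattice points `p`, `p + k • (-b, a)` with `0 < k`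
on the line where the primitive form `(a, b)` equals `ι ≥ 2` contains a lattice point at height
`ι - 1`. -/
lemma exists_intPt_height_sub_one {S : Set (ℚ × ℚ)} (hS : Convex ℚ S) (h0 : (0 : ℚ × ℚ) ∈ S)
    {a b x y m n ι k : ℤ} (hι : 2 ≤ ι) (hxy : a * x + b * y = 1) (hp : a * m + b * n = ι)
    (hk : 0 < k) (hpS : ((m : ℚ), (n : ℚ)) ∈ S)
    (hqS : (((m - b * k : ℤ) : ℚ), ((n + a * k : ℤ) : ℚ)) ∈ S) :
    ∃ s, IsIntPt s ∧ s ∈ S ∧ (a : ℚ) * s.1 + (b : ℚ) * s.2 = (ι : ℚ) - 1 := by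
  obtain ⟨A, hA1, hA2⟩ := exists_eq_mul_of_bezout (m := m - ι * x) (n := n - ι * y) hxy
    (by linear_combination hp - ι * hxy)
  have hdiv := Int.emod_add_mul_ediv A ι
  have hc0 := Int.emod_nonneg A (show ι ≠ 0 by lia)
  have hcι := Int.emod_lt_of_pos A (show 0 < ι by lia)
  set c := A % ι
  set t := A / ι
  have hm : m = ι * (x - b * t) - b * c := by linear_combination hA1 + b * hdiv
  have hn : n = ι * (y + a * t) + a * c := by linear_combination hA2 - a * hdiv
  refine ⟨(((m - (x - b * t) : ℤ) : ℚ), ((n - (y + a * t) : ℤ) : ℚ)), ⟨_, _, rfl⟩, ?_, ?_⟩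
  · have hιQ : (0 : ℚ) < ι := by exact_mod_cast (show 0 < ι by lia)
    have hkQ : (1 : ℚ) ≤ k := by exact_mod_cast hk
    have hkQ0 : (0 : ℚ) < k := by linarith
    have hcQ : (0 : ℚ) ≤ c := by exact_mod_cast hc0
    have hcιQ : (c : ℚ) + 1 ≤ ι := by exact_mod_cast hcι
    have hmQ : (m : ℚ) = ι * (x - b * t) - b * c := by exact_mod_cast hm
    have hnQ : (n : ℚ) = ι * (y + a * t) + a * c := by exact_mod_cast hn
    have hle : (c : ℚ) / k ≤ c := div_le_self hcQ hkQ
    have hmem := hS.sum_mem (t := Finset.univ)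
      (w := ![1 / (ι : ℚ), (ι - 1 - c / k) / ι, c / k / ι])
      (z := ![0, ((m : ℚ), (n : ℚ)), (((m - b * k : ℤ) : ℚ), ((n + a * k : ℤ) : ℚ))])
      (by
        intro i _
        fin_cases i
        · simpa using hιQ.le
        · exact div_nonneg (by linarith) hιQ.le
        · exact div_nonneg (div_nonneg hcQ hkQ0.le) hιQ.le)
      (by
        simp only [Fin.sum_univ_three, Matrix.cons_val]
        field_simp
        ring)
      (by
        intro i _
        fin_cases i
        exacts [h0, hpS, hqS])
    convert hmem using 1
    simp only [Fin.sum_univ_three, Matrix.cons_val, smul_zero, zero_add, Prod.smul_mk,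
      Prod.mk_add_mk, smul_eq_mul, Prod.mk.injEq]
    push_cast
    constructor
    · field_simp
      linear_combination (k : ℚ) * hmQ
    · field_simp
      linear_combination (k : ℚ) * hnQ
  · have hpQ : (a : ℚ) * m + b * n = ι := by exact_mod_cast hp
    have hxyQ : (a : ℚ) * x + b * y = 1 := by exact_mod_cast hxy
    push_cast
    linear_combination hpQ - hxyQ

/-- Let `P = conv(0, v₁, …, v_r) ⊆ ℚ²` be a full-dimensional ℚ-Gorenstein
polytope of index `ι ≥ 2` with witnessing integral linear form `(α1, α2)`.
If `P` contains two distinct nonzero lattice points, then `P` is not canonical: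
some nonzero lattice point of `P` does not lie on the level-`ι` hyperplane. -/
theorem not_canonical_of_two_lattice_points
    (r : ℕ) (hr : 2 ≤ r) (v : Fin r → ℚ × ℚ) (ι : ℤ) (hι : 2 ≤ ι)
    (hne : ∀ i, v i ≠ 0)
    (hdist : ∀ i j, i ≠ j → v i ≠ v j)
    (hfull : ∃ i j : Fin r, (v i).1 * (v j).2 - (v i).2 * (v j).1 ≠ 0)
    (hvert : ∀ p ∈ insert (0 : ℚ × ℚ) (Set.range v),
      p ∉ convexHull ℚ (insert (0 : ℚ × ℚ) (Set.range v) \ {p}))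
    (α1 α2 : ℤ)
    (hα : ∀ i, (α1 : ℚ) * (v i).1 + (α2 : ℚ) * (v i).2 = (ι : ℚ))
    (hmin : ∀ ι' : ℤ, 0 < ι' → ι' < ι →
      ¬ ∃ β1 β2 : ℤ, ∀ i, (β1 : ℚ) * (v i).1 + (β2 : ℚ) * (v i).2 = (ι' : ℚ))
    (p q : ℚ × ℚ) (hp : IsIntPt p) (hq : IsIntPt q)
    (hpP : p ∈ convexHull ℚ (insert (0 : ℚ × ℚ) (Set.range v)))
    (hqP : q ∈ convexHull ℚ (insert (0 : ℚ × ℚ) (Set.range v)))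
    (hp0 : p ≠ 0) (hq0 : q ≠ 0) (hpq : p ≠ q) :
    ∃ s : ℚ × ℚ, IsIntPt s ∧ s ∈ convexHull ℚ (insert (0 : ℚ × ℚ) (Set.range v)) ∧
      s ≠ 0 ∧ (α1 : ℚ) * s.1 + (α2 : ℚ) * s.2 ≠ (ι : ℚ) := by
  by_contra! hcan
  have hpι := hcan p hp hpP hp0
  have hqι := hcan q hq hqP hq0
  obtain ⟨m, n, rfl⟩ := hp
  obtain ⟨m', n', rfl⟩ := hq
  dsimp only at hpι hqι
  have hp' : α1 * m + α2 * n = ι := by exact_mod_cast hpι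
  have hq' : α1 * m' + α2 * n' = ι := by exact_mod_cast hqι
  have hgcd : Int.gcd α1 α2 = 1 := by
    by_contra hg
    obtain ⟨b1, hb1⟩ := Int.gcd_dvd_left α1 α2
    obtain ⟨b2, hb2⟩ := Int.gcd_dvd_right α1 α2
    set g : ℤ := (Int.gcd α1 α2 : ℤ)
    have hι' : ι = g * (b1 * m + b2 * n) := by
      linear_combination -hp' + m * hb1 + n * hb2
    have hg0 : g ≠ 0 := by
      intro h
      rw [h, zero_mul] at hι'
      lia
    have hg2 : 2 ≤ g := by lia
    have hpos : 0 < b1 * m + b2 * n := by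
      by_contra! h
      nlinarith
    refine hmin _ hpos (by nlinarith) ⟨b1, b2, fun i ↦ ?_⟩
    have hgQ : (g : ℚ) ≠ 0 := by exact_mod_cast hg0
    have h1 : (α1 : ℚ) = g * b1 := by exact_mod_cast hb1
    have h2 : (α2 : ℚ) = g * b2 := by exact_mod_cast hb2
    have h3 : (ι : ℚ) = g * ((b1 * m + b2 * n : ℤ) : ℚ) := by exact_mod_cast hι'
    have h4 := hα i
    rw [h1, h2, h3] at h4
    exact mul_left_cancel₀ hgQ (by linear_combination h4)
  obtain ⟨x, y, hxy⟩ : ∃ x y : ℤ, α1 * x + α2 * y = 1 :=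
    ⟨_, _, by rw [← Int.gcd_eq_gcd_ab, hgcd, Nat.cast_one]⟩
  obtain ⟨k, hk1, hk2⟩ := exists_eq_mul_of_bezout (m := m' - m) (n := n' - n) hxy
    (by linear_combination hq' - hp')
  have hS := convex_convexHull ℚ (insert (0 : ℚ × ℚ) (Set.range v))
  have h0 := subset_convexHull ℚ _ (Set.mem_insert (0 : ℚ × ℚ) (Set.range v))
  obtain ⟨s, hs, hsP, hsα⟩ : ∃ s, IsIntPt s ∧
      s ∈ convexHull ℚ (insert (0 : ℚ × ℚ) (Set.range v)) ∧
      (α1 : ℚ) * s.1 + (α2 : ℚ) * s.2 = (ι : ℚ) - 1 := by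
    rcases lt_trichotomy k 0 with hk | rfl | hk
    · refine exists_intPt_height_sub_one hS h0 hι hxy hq' (k := -k) (by lia) hqP ?_
      rwa [show m' - α2 * -k = m by linear_combination hk1,
        show n' + α1 * -k = n by linear_combination hk2]
    · refine absurd ?_ hpq
      rw [show m' = m by lia, show n' = n by lia]
    · refine exists_intPt_height_sub_one hS h0 hι hxy hp' hk hpP ?_
      rwa [show m - α2 * k = m' by linear_combination -hk1,
        show n + α1 * k = n' by linear_combination -hk2]
  have hs0 : s ≠ 0 := by
    rintro rfl
    have hι1 : (0 : ℚ) = ι - 1 := by simpa using hsα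
    have : (2 : ℚ) ≤ ι := by exact_mod_cast hι
    linarith
  linarith [hcan s hs hsP hs0]
end

section
/- Let k ∈ ℤ and let ι, q ∈ ℤ with ι ≥ 2 and q ≥ 2, and set P = conv((0,0), (k,ι), (k + 1/q, ι)) ⊆ ℚ². Then P ∩ ℤ² = {(0,0), (k,ι)} (equivalently, P is canonical) if and only if there exists an integer c with 0 < c < q and kc ≡ −1 (mod ι). -/
/-- The set of lattice points of `ℚ²`. -/
def intPts : Set (ℚ × ℚ) := {p | ∃ m n : ℤ, p = ((m : ℚ), (n : ℚ))}

/-- The triangle `conv((0,0), (k,ι), (k + 1/q, ι))` described by linear inequalities. -/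
theorem mem_convexHull_triangle_iff {k ι q : ℚ} (hι : 0 < ι) (hq : 0 < q) (x y : ℚ) :
    (x, y) ∈ convexHull ℚ ({((0 : ℚ), (0 : ℚ)), (k, ι), (k + 1 / q, ι)} : Set (ℚ × ℚ)) ↔
      y ≤ ι ∧ 0 ≤ ι * x - k * y ∧ q * (ι * x - k * y) ≤ y := by
  constructor
  · intro h
    have hconv : Convex ℚ {p : ℚ × ℚ | p.2 ≤ ι ∧ 0 ≤ ι * p.1 - k * p.2 ∧
        q * (ι * p.1 - k * p.2) ≤ p.2} := by
      rintro ⟨x₁, y₁⟩ ⟨h₁, h₂, h₃⟩ ⟨x₂, y₂⟩ ⟨h₄, h₅, h₆⟩ a b ha hb hab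
      simp only [Set.mem_ofPred_eq, Prod.smul_mk, Prod.mk_add_mk, smul_eq_mul] at *
      refine ⟨?_, ?_, ?_⟩
      · calc a * y₁ + b * y₂ ≤ a * ι + b * ι := by gcongr
          _ = ι := by rw [← add_mul, hab, one_mul]
      · linarith [mul_nonneg ha h₂, mul_nonneg hb h₅]
      · linarith [mul_le_mul_of_nonneg_left h₃ ha, mul_le_mul_of_nonneg_left h₆ hb]
    refine convexHull_min ?_ hconv h
    rintro p (rfl | rfl | rfl)
    · simpa using hι.le
    · simp [mul_comm k ι, hι.le]
    · have hd : ι * (k + 1 / q) - k * ι = ι / q := by field_simp; ring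
      refine ⟨le_rfl, ?_, ?_⟩
      · simp only [hd]; positivity
      · simp only [hd]; exact (mul_div_cancel₀ ι hq.ne').le
  · rintro ⟨h₁, h₂, h₃⟩
    have hmem := (convex_convexHull ℚ
      ({((0 : ℚ), (0 : ℚ)), (k, ι), (k + 1 / q, ι)} : Set (ℚ × ℚ))).sum_mem
      (t := Finset.univ)
      (w := ![1 - y / ι, (y - q * (ι * x - k * y)) / ι, q * (ι * x - k * y) / ι])
      (z := ![((0 : ℚ), (0 : ℚ)), (k, ι), (k + 1 / q, ι)]) ?_ ?_ ?_
    · convert hmem using 1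
      simp only [Fin.sum_univ_three, Matrix.cons_val, Prod.smul_mk, Prod.mk_add_mk, smul_eq_mul,
        Prod.mk.injEq]
      constructor <;> field_simp <;> ring
    · have hy : y / ι ≤ 1 := (div_le_one hι).2 h₁
      intro i _
      fin_cases i
      · simpa using hy
      · exact div_nonneg (sub_nonneg.2 h₃) hι.le
      · exact div_nonneg (mul_nonneg hq.le h₂) hι.le
    · simp only [Fin.sum_univ_three, Matrix.cons_val]
      field_simp
      ring
    · intro i _
      apply subset_convexHull
      fin_cases i <;> simp

theorem mem_intPts_iff {p : ℚ × ℚ} : p ∈ intPts ↔ ∃ m n : ℤ, p = ((m : ℚ), (n : ℚ)) :=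
  Iff.rfl

/-- Integral version of `mem_convexHull_triangle_iff`. -/
theorem intCast_mem_convexHull_triangle_iff {k ι q : ℤ} (hι : 0 < ι) (hq : 0 < q) (m n : ℤ) :
    ((m : ℚ), (n : ℚ)) ∈ convexHull ℚ ({((0 : ℚ), (0 : ℚ)), ((k : ℚ), (ι : ℚ)),
        ((k : ℚ) + 1 / (q : ℚ), (ι : ℚ))} : Set (ℚ × ℚ)) ↔
      n ≤ ι ∧ 0 ≤ ι * m - k * n ∧ q * (ι * m - k * n) ≤ n := by
  rw [mem_convexHull_triangle_iff (by exact_mod_cast hι) (by exact_mod_cast hq)]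
  norm_cast

/-- The rational polygon `conv((0,0), (k,ι), (k + 1/q, ι))` with `ι, q ≥ 2` is
canonical (its only lattice points are `(0,0)` and `(k,ι)`) if and only if
there is an integer `0 < c < q` with `k·c ≡ −1 (mod ι)`. -/
theorem canonical_iff_exists_c (k ι q : ℤ) (hι : 2 ≤ ι) (hq : 2 ≤ q) :
    convexHull ℚ ({((0 : ℚ), (0 : ℚ)), ((k : ℚ), (ι : ℚ)),
        ((k : ℚ) + 1 / (q : ℚ), (ι : ℚ))} : Set (ℚ × ℚ)) ∩ intPts
      = {((0 : ℚ), (0 : ℚ)), ((k : ℚ), (ι : ℚ))} ↔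
    ∃ c : ℤ, 0 < c ∧ c < q ∧ Int.ModEq ι (k * c) (-1) := by
  have hι₀ : 0 < ι := by lia
  have hq₀ : 0 < q := by lia
  constructor
  · intro h
    have key : ∀ m n : ℤ, n ≤ ι → 0 ≤ ι * m - k * n → q * (ι * m - k * n) ≤ n →
        n = 0 ∨ n = ι := by
      intro m n h₁ h₂ h₃
      have hmem : ((m : ℚ), (n : ℚ)) ∈ ({((0 : ℚ), (0 : ℚ)), ((k : ℚ), (ι : ℚ))} :
          Set (ℚ × ℚ)) := by
        rw [← h]
        exact ⟨(intCast_mem_convexHull_triangle_iff hι₀ hq₀ m n).2 ⟨h₁, h₂, h₃⟩,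
          mem_intPts_iff.2 ⟨m, n, rfl⟩⟩
      simp only [Set.mem_insert_iff, Set.mem_singleton_iff, Prod.mk.injEq] at hmem
      norm_cast at hmem
      exact hmem.imp And.right And.right
    have hcop : Int.gcd k ι = 1 := by
      obtain ⟨a, ha⟩ := Int.gcd_dvd_left k ι
      obtain ⟨b, hb⟩ := Int.gcd_dvd_right k ι
      have hg : 0 < (Int.gcd k ι : ℤ) := by
        exact_mod_cast Int.gcd_pos_of_ne_zero_right k hι₀.ne'
      generalize hgd : Int.gcd k ι = g at *
      have hb₀ : 0 < b := by
        by_contra hb'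
        nlinarith
      have hd : ι * a - k * b = 0 := by rw [ha, hb]; ring
      rcases key a b (by nlinarith) hd.ge (by rw [hd]; lia) with h₀ | h₀
      · lia
      · have : ((g : ℤ) - 1) * b = 0 := by linarith
        rcases mul_eq_zero.1 this with h' | h' <;> lia
    have hbez : (1 : ℤ) = k * Int.gcdA k ι + ι * Int.gcdB k ι := by
      rw [← Int.gcd_eq_gcd_ab, hcop, Nat.cast_one]
    set c := (-Int.gcdA k ι) % ι with hc
    obtain ⟨m, hm⟩ : ι ∣ k * c + 1 := by
      refine ⟨Int.gcdB k ι - k * (-Int.gcdA k ι / ι), ?_⟩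
      have := Int.emod_add_mul_ediv (-Int.gcdA k ι) ι
      rw [← hc] at this
      linear_combination k * this + hbez
    have hc_nonneg : 0 ≤ c := Int.emod_nonneg _ hι₀.ne'
    have hc_lt : c < ι := Int.emod_lt_of_pos _ hι₀
    have hc_pos : 0 < c := by
      refine hc_nonneg.lt_of_ne fun h₀ ↦ ?_
      rw [← h₀, mul_zero, zero_add] at hm
      have := Int.le_of_dvd one_pos ⟨m, hm⟩
      lia
    refine ⟨c, hc_pos, ?_, ?_⟩
    · by_contra! hqc
      have hd : ι * m - k * c = 1 := by linarith
      rcases key m c hc_lt.le (by lia) (by rw [hd]; lia) with h₀ | h₀ <;> lia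
    · exact (Int.modEq_iff_dvd.2 ⟨m, by linarith⟩).symm
  · rintro ⟨c, hc_pos, hcq, hmod⟩
    obtain ⟨e, he⟩ := hmod.dvd
    ext p
    constructor
    · rintro ⟨hp, hint⟩
      obtain ⟨m, n, rfl⟩ := mem_intPts_iff.1 hint
      obtain ⟨h₁, h₂, h₃⟩ := (intCast_mem_convexHull_triangle_iff hι₀ hq₀ m n).1 hp
      set d := ι * m - k * n with hd
      obtain ⟨j, hj⟩ : ι ∣ n - c * d := ⟨-c * m - e * n, by
        rw [hd]; linear_combination (-n) * he⟩
      have hn : 0 ≤ n := le_trans (by positivity) h₃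
      have hd₀ : d = 0 := by
        by_contra hne
        have hpos : 0 < d := h₂.lt_of_ne' hne
        have h₅ : 0 < ι * j := by rw [← hj]; nlinarith
        have h₆ : ι * j < ι := by rw [← hj]; nlinarith
        have h₇ : 0 < j := by by_contra!; nlinarith
        nlinarith
      rw [hd₀, mul_zero, sub_zero] at hj
      have hj₀ : 0 ≤ j := by by_contra!; nlinarith
      have hj₁ : j ≤ 1 := by by_contra!; nlinarith
      have hm : m = k * j := by
        apply mul_left_cancel₀ hι₀.ne'
        rw [hj] at hd
        linarith
      subst hj hm
      obtain rfl | rfl : j = 0 ∨ j = 1 := by lia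
      · left; simp
      · right; simp
    · rintro (rfl | rfl)
      · exact ⟨subset_convexHull ℚ _ (by simp), mem_intPts_iff.2 ⟨0, 0, by simp⟩⟩
      · exact ⟨subset_convexHull ℚ _ (by simp), mem_intPts_iff.2 ⟨k, ι, rfl⟩⟩
end

section
/- Let k ∈ ℤ and ι ∈ ℤ with ι ≥ 2, and set P = conv((0,0), (k,ι), (k + 1/2, ι)) ⊆ ℚ². Then P ∩ ℤ² = {(0,0), (k,ι)} (equivalently, P is canonical) if and only if k + 1 is a multiple of ι; in that case P is lattice equivalent to conv((0,0), (1/2, ι), (1, ι)). -/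
/-- Lattice equivalence of subsets of `ℚ²`: one is the image of the other
under `v ↦ A v + w` with `A ∈ GL₂(ℤ)` and `w ∈ ℤ²`. -/
def LatticeEquiv (S S' : Set (ℚ × ℚ)) : Prop :=
  ∃ a b c d w1 w2 : ℤ, (a * d - b * c = 1 ∨ a * d - b * c = -1) ∧
    S' = (fun p : ℚ × ℚ =>
      ((a : ℚ) * p.1 + (b : ℚ) * p.2 + (w1 : ℚ),
       (c : ℚ) * p.1 + (d : ℚ) * p.2 + (w2 : ℚ))) '' S

/-- Inequalities cutting out the triangle `conv((0,0), (k,ι), (k + 1/2, ι))`. -/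
lemma mem_convexHull_half_cone {k ι : ℚ} (hι : 0 < ι) (x y : ℚ) :
    (x, y) ∈ convexHull ℚ ({((0 : ℚ), (0 : ℚ)), (k, ι), (k + 1 / 2, ι)} : Set (ℚ × ℚ)) ↔
      y ≤ ι ∧ k * y ≤ x * ι ∧ 2 * (x * ι) ≤ (2 * k + 1) * y := by
  constructor
  · intro h
    have hconv : Convex ℚ {p : ℚ × ℚ | p.2 ≤ ι ∧ k * p.2 ≤ p.1 * ι ∧
        2 * (p.1 * ι) ≤ (2 * k + 1) * p.2} := by
      rintro ⟨x₁, y₁⟩ ⟨h₁, h₂, h₃⟩ ⟨x₂, y₂⟩ ⟨h₄, h₅, h₆⟩ a b ha hb hab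
      obtain rfl : b = 1 - a := by linarith
      dsimp only at h₁ h₂ h₃ h₄ h₅ h₆
      simp only [Set.mem_ofPred_eq, Prod.smul_mk, Prod.mk_add_mk, smul_eq_mul]
      have e₁ := mul_le_mul_of_nonneg_left h₁ ha
      have e₂ := mul_le_mul_of_nonneg_left h₂ ha
      have e₃ := mul_le_mul_of_nonneg_left h₃ ha
      have e₄ := mul_le_mul_of_nonneg_left h₄ hb
      have e₅ := mul_le_mul_of_nonneg_left h₅ hb
      have e₆ := mul_le_mul_of_nonneg_left h₆ hb
      refine ⟨?_, ?_, ?_⟩ <;> linarith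
    refine convexHull_min ?_ hconv h
    rintro p (rfl | rfl | rfl)
    · simp [hι.le]
    · simp only [Set.mem_ofPred_eq]
      refine ⟨le_rfl, le_rfl, ?_⟩
      linarith
    · simp only [Set.mem_ofPred_eq]
      refine ⟨le_rfl, ?_, ?_⟩ <;> linarith
  · rintro ⟨h₁, h₂, h₃⟩
    set S : Set (ℚ × ℚ) := {((0 : ℚ), (0 : ℚ)), (k, ι), (k + 1 / 2, ι)}
    have hsum := (convex_convexHull ℚ S).sum_mem (t := Finset.univ)
      (w := ![(ι - y) / ι, ((2 * k + 1) * y - 2 * (x * ι)) / ι, 2 * (x * ι - k * y) / ι])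
      (z := ![(0, 0), (k, ι), (k + 1 / 2, ι)])
      (by
        intro i _
        fin_cases i
        · exact div_nonneg (by linarith) hι.le
        · exact div_nonneg (by linarith) hι.le
        · exact div_nonneg (by linarith) hι.le)
      (by
        simp [Fin.sum_univ_three]
        field_simp
        ring)
      (by
        intro i _
        apply subset_convexHull
        fin_cases i <;> simp [S])
    convert hsum using 1
    simp only [Fin.sum_univ_three, Matrix.cons_val, Prod.smul_mk, Prod.mk_add_mk, smul_eq_mul]
    ext
    · field_simp
      ring
    · field_simp
      ring

/-- Lattice points of the triangle `conv((0,0), (k,ι), (k + 1/2, ι))`. -/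
lemma intCast_mem_convexHull_half_cone {k ι : ℤ} (hι : 0 < ι) (m n : ℤ) :
    ((m : ℚ), (n : ℚ)) ∈ convexHull ℚ ({((0 : ℚ), (0 : ℚ)), ((k : ℚ), (ι : ℚ)),
        ((k : ℚ) + 1 / 2, (ι : ℚ))} : Set (ℚ × ℚ)) ↔
      n ≤ ι ∧ k * n ≤ m * ι ∧ 2 * (m * ι) ≤ (2 * k + 1) * n := by
  rw [mem_convexHull_half_cone (by exact_mod_cast hι)]
  norm_cast

/-- If `ι ∤ k + 1`, some lattice point lies strictly below the top edge. -/
lemma exists_interior_of_not_dvd {k ι : ℤ} (hι : 2 ≤ ι) (h : ¬ ι ∣ k + 1) :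
    ∃ m n : ℤ, 0 < n ∧ n < ι ∧ k * n ≤ m * ι ∧ 2 * (m * ι) ≤ (2 * k + 1) * n := by
  by_cases hg : IsCoprime k ι
  · obtain ⟨u, v, huv⟩ := hg
    have hdiv := Int.emod_add_mul_ediv (-u) ι
    have hnn := Int.emod_nonneg (-u) (show ι ≠ 0 by omega)
    have hlt := Int.emod_lt_of_pos (-u) (show 0 < ι by omega)
    set n := (-u) % ι
    set q := (-u) / ι
    have key : k * n + 1 = (v - k * q) * ι := by linear_combination k * hdiv - huv
    have h0 : n ≠ 0 := by
      intro h0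
      rw [h0] at key
      have : ι ∣ 1 := ⟨v - k * q, by linarith⟩
      have := Int.le_of_dvd one_pos this
      omega
    have h1 : n ≠ 1 := by
      intro h1
      rw [h1] at key
      exact h ⟨v - k * q, by linarith⟩
    have h2 : 2 ≤ n := by omega
    refine ⟨v - k * q, n, by omega, hlt, ?_, ?_⟩ <;> linarith
  · have hne : Int.gcd k ι ≠ 1 := fun h ↦ hg (Int.isCoprime_iff_gcd_eq_one.2 h)
    have hpos : 0 < Int.gcd k ι := Int.gcd_pos_of_ne_zero_right k (by omega)
    obtain ⟨a, ha⟩ := Int.gcd_dvd_left k ι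
    obtain ⟨n, hn⟩ := Int.gcd_dvd_right k ι
    have hg2 : (2 : ℤ) ≤ (Int.gcd k ι : ℤ) := by omega
    generalize (Int.gcd k ι : ℤ) = g at *
    have hn0 : 0 < n := by
      by_contra! hn0
      nlinarith
    have heq : k * n = a * ι := by rw [ha, hn]; ring
    refine ⟨a, n, hn0, by nlinarith, by linarith, by linarith⟩

/-- The rational polygon `conv((0,0), (k,ι), (k + 1/2, ι))` with `ι ≥ 2` is
canonical if and only if `ι ∣ k + 1`; in that case it is lattice equivalent to
`conv((0,0), (1/2, ι), (1, ι))`. -/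
theorem canonical_half_cone (k ι : ℤ) (hι : 2 ≤ ι) :
    (convexHull ℚ ({((0 : ℚ), (0 : ℚ)), ((k : ℚ), (ι : ℚ)),
          ((k : ℚ) + 1 / 2, (ι : ℚ))} : Set (ℚ × ℚ)) ∩ intPts
        = {((0 : ℚ), (0 : ℚ)), ((k : ℚ), (ι : ℚ))} ↔ ι ∣ (k + 1)) ∧
    (ι ∣ (k + 1) →
      LatticeEquiv
        (convexHull ℚ ({((0 : ℚ), (0 : ℚ)), ((k : ℚ), (ι : ℚ)),
          ((k : ℚ) + 1 / 2, (ι : ℚ))} : Set (ℚ × ℚ)))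
        (convexHull ℚ ({((0 : ℚ), (0 : ℚ)), ((1 / 2 : ℚ), (ι : ℚ)),
          ((1 : ℚ), (ι : ℚ))} : Set (ℚ × ℚ)))) := by
  have hpos : 0 < ι := by omega
  refine ⟨⟨fun h ↦ ?_, ?_⟩, ?_⟩
  · by_contra hdvd
    obtain ⟨m, n, hn, hnι, h₁, h₂⟩ := exists_interior_of_not_dvd hι hdvd
    have hmem : ((m : ℚ), (n : ℚ)) ∈ ({((0 : ℚ), (0 : ℚ)), ((k : ℚ), (ι : ℚ))} : Set (ℚ × ℚ)) :=
      h ▸ ⟨(intCast_mem_convexHull_half_cone hpos m n).2 ⟨hnι.le, h₁, h₂⟩, m, n, rfl⟩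
    simp only [Set.mem_insert_iff, Set.mem_singleton_iff, Prod.mk.injEq] at hmem
    norm_cast at hmem
    omega
  · rintro ⟨t, ht⟩
    obtain rfl : k = ι * t - 1 := by linarith
    ext p
    constructor
    · rintro ⟨hp, m, n, rfl⟩
      obtain ⟨h₁, h₂, h₃⟩ := (intCast_mem_convexHull_half_cone hpos m n).1 hp
      simp only [Set.mem_insert_iff, Set.mem_singleton_iff, Prod.mk.injEq]
      norm_cast
      have hs₁ : 0 ≤ ι * (m - t * n) + n := by linarith
      have hs₂ : 2 * (ι * (m - t * n)) + n ≤ 0 := by linarith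
      have hs₃ : -1 ≤ m - t * n := by
        by_contra! hs
        nlinarith
      have hs₄ : m - t * n ≤ 0 := by
        by_contra! hs
        nlinarith
      obtain hs | hs : m - t * n = 0 ∨ m - t * n = -1 := by omega
      · rw [hs] at hs₁ hs₂
        obtain rfl : n = 0 := by omega
        left
        exact ⟨by linarith, rfl⟩
      · rw [hs] at hs₁ hs₂
        obtain rfl : n = ι := by omega
        right
        exact ⟨by linarith, rfl⟩
    · rintro (rfl | rfl)
      · exact ⟨subset_convexHull _ _ (by simp), 0, 0, by simp⟩
      · exact ⟨subset_convexHull _ _ (by simp), _, _, rfl⟩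
  · rintro ⟨t, ht⟩
    have htq : (k : ℚ) + 1 = ι * t := by exact_mod_cast ht
    refine ⟨-1, t, 0, 1, 0, 0, Or.inr (by ring), ?_⟩
    have hlin : IsLinearMap ℚ (fun p : ℚ × ℚ =>
        (((-1 : ℤ) : ℚ) * p.1 + (t : ℚ) * p.2 + ((0 : ℤ) : ℚ),
          ((0 : ℤ) : ℚ) * p.1 + ((1 : ℤ) : ℚ) * p.2 + ((0 : ℤ) : ℚ))) := by
      constructor
      · intro p q
        ext <;> simp
        ring
      · intro c p
        ext <;> simp
        ring
    rw [hlin.image_convexHull, Set.image_insert_eq, Set.image_pair]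
    have e₁ : ((-1 : ℤ) : ℚ) * k + t * ι + ((0 : ℤ) : ℚ) = 1 := by
      push_cast
      linarith
    have e₂ : ((-1 : ℤ) : ℚ) * (k + 1 / 2) + t * ι + ((0 : ℤ) : ℚ) = 1 / 2 := by
      push_cast
      linarith
    simp only [e₁, e₂]
    simp [Set.pair_comm]
end

section
/- Let k ∈ ℤ and ι ∈ ℤ with ι ≥ 2, and set P = conv((0,0), (k − 1/2, ι), (k + 1/2, ι)) ⊆ ℚ². Then P ∩ ℤ² = {(0,0), (k,ι)} (equivalently, P is canonical) if and only if ι = 2 and k is odd. -/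
/-- The triangle `conv((0,0), (k − 1/2, ι), (k + 1/2, ι))` in terms of inequalities. -/
theorem mem_convexHull_halfhalf_iff {k ι : ℚ} (hι : 0 < ι) (x y : ℚ) :
    (x, y) ∈ convexHull ℚ ({(0, 0), (k - 1 / 2, ι), (k + 1 / 2, ι)} : Set (ℚ × ℚ)) ↔
      y ≤ ι ∧ 2 * (ι * x - k * y) ≤ y ∧ -y ≤ 2 * (ι * x - k * y) := by
  constructor
  · intro h
    rw [convexHull_insert (Set.insert_nonempty _ _), convexHull_pair] at h
    simp only [mem_convexJoin, Set.mem_singleton_iff, exists_eq_left] at h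
    obtain ⟨_, ⟨c, d, hc, hd, hcd, rfl⟩, a, b, ha, hb, hab, h⟩ := h
    simp only [Prod.smul_mk, smul_eq_mul, Prod.mk_add_mk, Prod.mk.injEq] at h
    obtain ⟨rfl, rfl⟩ := h
    obtain rfl : c = 1 - d := by linarith
    obtain rfl : a = 1 - b := by linarith
    have hbι : 0 ≤ b * ι := by positivity
    have h₁ := mul_nonneg hbι hc
    have h₂ := mul_nonneg hbι hd
    refine ⟨?_, ?_, ?_⟩
    · nlinarith [mul_nonneg ha hι.le]
    · linarith
    · linarith
  · rintro ⟨h₁, h₂, h₃⟩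
    have hmem := (convex_convexHull ℚ
      ({(0, 0), (k - 1 / 2, ι), (k + 1 / 2, ι)} : Set (ℚ × ℚ))).sum_mem
      (t := Finset.univ)
      (w := ![1 - y / ι, (y - 2 * (ι * x - k * y)) / (2 * ι),
        (y + 2 * (ι * x - k * y)) / (2 * ι)])
      (z := ![(0, 0), (k - 1 / 2, ι), (k + 1 / 2, ι)])
      (by
        have h₄ : 0 ≤ 1 - y / ι := sub_nonneg.2 ((div_le_one hι).2 h₁)
        have h₅ : 0 ≤ (y - 2 * (ι * x - k * y)) / (2 * ι) :=
          div_nonneg (by linarith) (by linarith)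
        have h₆ : 0 ≤ (y + 2 * (ι * x - k * y)) / (2 * ι) :=
          div_nonneg (by linarith) (by linarith)
        intro i _
        fin_cases i
        exacts [h₄, h₅, h₆])
      (by
        simp only [Fin.sum_univ_three, Matrix.cons_val]
        field_simp
        ring)
      (by
        intro i _
        apply subset_convexHull
        fin_cases i <;> simp)
    convert hmem using 1
    simp only [Fin.sum_univ_three, Matrix.cons_val, Prod.smul_mk, smul_eq_mul, Prod.mk_add_mk,
      Prod.mk.injEq]
    constructor
    · field_simp
      ring
    · field_simp
      ring

/-- The integral version of `mem_convexHull_halfhalf_iff`. -/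
theorem intCast_mem_convexHull_halfhalf_iff {k ι : ℤ} (hι : 0 < ι) (x y : ℤ) :
    ((x : ℚ), (y : ℚ)) ∈ convexHull ℚ ({((0 : ℚ), (0 : ℚ)), ((k : ℚ) - 1 / 2, (ι : ℚ)),
        ((k : ℚ) + 1 / 2, (ι : ℚ))} : Set (ℚ × ℚ)) ↔
      y ≤ ι ∧ 2 * (ι * x - k * y) ≤ y ∧ -y ≤ 2 * (ι * x - k * y) := by
  rw [mem_convexHull_halfhalf_iff (by exact_mod_cast hι)]
  norm_cast

/-- The rational polygon `conv((0,0), (k − 1/2, ι), (k + 1/2, ι))` with `ι ≥ 2`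
is canonical (its lattice points are exactly `(0,0)` and `(k,ι)`) if and only
if `ι = 2` and `k` is odd. -/
theorem canonical_halfhalf_cone (k ι : ℤ) (hι : 2 ≤ ι) :
    convexHull ℚ ({((0 : ℚ), (0 : ℚ)), ((k : ℚ) - 1 / 2, (ι : ℚ)),
        ((k : ℚ) + 1 / 2, (ι : ℚ))} : Set (ℚ × ℚ)) ∩ intPts
      = {((0 : ℚ), (0 : ℚ)), ((k : ℚ), (ι : ℚ))} ↔
    ι = 2 ∧ Odd k := by
  have hmem := intCast_mem_convexHull_halfhalf_iff (k := k) (ι := ι) (by lia)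
  constructor
  · intro h
    have key : ∀ x y : ℤ, 0 < y → y < ι → 2 * (ι * x - k * y) ≤ y →
        -y ≤ 2 * (ι * x - k * y) → False := by
      intro x y h₀ h₁ h₂ h₃
      have hxy := h.subset ⟨(hmem x y).2 ⟨h₁.le, h₂, h₃⟩, x, y, rfl⟩
      simp only [Set.mem_insert_iff, Set.mem_singleton_iff, Prod.mk.injEq] at hxy
      norm_cast at hxy
      lia
    obtain ⟨q, r, hk, hr₁, hr₂⟩ : ∃ q r : ℤ, k = ι * q + r ∧ -ι < 2 * r ∧ 2 * r ≤ ι := by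
      have h₁ := Int.mul_ediv_add_emod k ι
      have h₂ := Int.emod_nonneg k (by lia : ι ≠ 0)
      have h₃ := Int.emod_lt_of_pos k (by lia : 0 < ι)
      by_cases hr : 2 * (k % ι) ≤ ι
      · exact ⟨k / ι, k % ι, h₁.symm, by lia, hr⟩
      · exact ⟨k / ι + 1, k % ι - ι, by linarith, by lia, by lia⟩
    have hr : 2 * r = ι := by
      by_contra hne
      have hval : ι * (k - q) - k * (ι - 1) = r := by linarith
      exact key (k - q) (ι - 1) (by lia) (by lia) (by lia) (by lia)
    have hι₂ : ι = 2 := by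
      by_contra hne
      have hval : ι * (2 * q + 1) - k * 2 = 0 := by linarith
      exact key (2 * q + 1) 2 (by lia) (by lia) (by lia) (by lia)
    subst hι₂
    exact ⟨rfl, q, by lia⟩
  · rintro ⟨rfl, m, rfl⟩
    ext p
    constructor
    · rintro ⟨hp, x, y, rfl⟩
      obtain ⟨h₁, h₂, h₃⟩ := (hmem x y).1 hp
      simp only [Set.mem_insert_iff, Set.mem_singleton_iff, Prod.mk.injEq]
      norm_cast
      have h₀ : 0 ≤ y := by linarith
      interval_cases y <;> lia
    · rintro (rfl | rfl)
      · exact ⟨subset_convexHull _ _ (by simp), 0, 0, by simp⟩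
      · exact ⟨(hmem _ _).2 ⟨le_rfl, by lia, by lia⟩, _, _, rfl⟩
end

section
/- Let k ∈ ℤ and ι ∈ ℤ with ι ≥ 2, and set P = conv((0,0), (k,ι), (k + 1/3, ι)) ⊆ ℚ². Then P ∩ ℤ² = {(0,0), (k,ι)} (equivalently, P is canonical) if and only if either k + 1 is a multiple of ι, or ι is odd and k ≡ (ι − 1)/2 (mod ι). -/
/-- The inequalities cutting out the lattice points of the triangle. -/
theorem intCast_mem_convexHull_third_cone_iff (k ι m n : ℤ) (hι : 0 < ι) :
    ((m : ℚ), (n : ℚ)) ∈ convexHull ℚ ({((0 : ℚ), (0 : ℚ)), ((k : ℚ), (ι : ℚ)),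
        ((k : ℚ) + 1 / 3, (ι : ℚ))} : Set (ℚ × ℚ)) ↔
      n ≤ ι ∧ n * k ≤ m * ι ∧ 3 * (m * ι - n * k) ≤ n := by
  have hι' : (0 : ℚ) < ι := by exact_mod_cast hι
  constructor
  · intro h
    have hconv : Convex ℚ {p : ℚ × ℚ | p.2 ≤ ι ∧ p.2 * k ≤ p.1 * ι ∧
        3 * (p.1 * ι - p.2 * k) ≤ p.2} := by
      rintro ⟨x, y⟩ ⟨h1, h2, h3⟩ ⟨x', y'⟩ ⟨h1', h2', h3'⟩ a b ha hb hab
      simp only [Set.mem_ofPred_eq, Prod.smul_mk, Prod.mk_add_mk, smul_eq_mul] at *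
      obtain rfl : b = 1 - a := by linarith
      have := mul_le_mul_of_nonneg_left h1 ha
      have := mul_le_mul_of_nonneg_left h2 ha
      have := mul_le_mul_of_nonneg_left h3 ha
      have := mul_le_mul_of_nonneg_left h1' hb
      have := mul_le_mul_of_nonneg_left h2' hb
      have := mul_le_mul_of_nonneg_left h3' hb
      refine ⟨?_, ?_, ?_⟩ <;> linarith
    have hmem := convexHull_min (s := {((0 : ℚ), (0 : ℚ)), ((k : ℚ), (ι : ℚ)),
        ((k : ℚ) + 1 / 3, (ι : ℚ))}) (by
      rintro p (rfl | rfl | rfl) <;> refine ⟨?_, ?_, ?_⟩ <;> dsimp only <;> linarith) hconv h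
    obtain ⟨h1, h2, h3⟩ := hmem
    dsimp only at h1 h2 h3
    exact ⟨by exact_mod_cast h1, by exact_mod_cast h2, by exact_mod_cast h3⟩
  · rintro ⟨h1, h2, h3⟩
    have h1' : (n : ℚ) ≤ ι := by exact_mod_cast h1
    have h2' : (n : ℚ) * k ≤ m * ι := by exact_mod_cast h2
    have h3' : 3 * ((m : ℚ) * ι - n * k) ≤ n := by exact_mod_cast h3
    refine mem_convexHull_of_exists_fintype
      ![(ι - n) / (ι : ℚ), (n - 3 * (m * ι - n * k)) / (ι : ℚ), 3 * (m * ι - n * k) / (ι : ℚ)]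
      ![((0 : ℚ), (0 : ℚ)), ((k : ℚ), (ι : ℚ)), ((k : ℚ) + 1 / 3, (ι : ℚ))] ?_ ?_ ?_ ?_
    · intro i
      fin_cases i
      · exact div_nonneg (by linarith) hι'.le
      · exact div_nonneg (by linarith) hι'.le
      · exact div_nonneg (by linarith) hι'.le
    · simp only [Fin.sum_univ_three, Matrix.cons_val]
      field_simp
      ring
    · intro i
      fin_cases i <;> simp
    · simp only [Fin.sum_univ_three, Matrix.cons_val, Prod.smul_mk, Prod.mk_add_mk, smul_eq_mul,
        Prod.mk.injEq]
      constructor <;> field_simp <;> ring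

/-- If every lattice point of the triangle below the top edge is the origin, then `k ≡ -1` or
`2 k ≡ -1` modulo `ι`. -/
theorem dvd_add_one_or_dvd_two_mul_add_one (k ι : ℤ) (hι : 2 ≤ ι)
    (h : ∀ m n : ℤ, 0 < n → n < ι → n * k ≤ m * ι → n < 3 * (m * ι - n * k)) :
    ι ∣ k + 1 ∨ ι ∣ 2 * k + 1 := by
  have hcop : IsCoprime k ι := by
    rw [Int.isCoprime_iff_gcd_eq_one]
    by_contra hg
    obtain ⟨a, ha⟩ := Int.gcd_dvd_left k ι
    obtain ⟨b, hb⟩ := Int.gcd_dvd_right k ι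
    have hg0 : 0 < Int.gcd k ι := Int.gcd_pos_of_ne_zero_right _ (by omega)
    have hg2 : (2 : ℤ) ≤ Int.gcd k ι := by omega
    generalize (Int.gcd k ι : ℤ) = g at *
    have hb0 : 0 < b := by
      by_contra hb0
      nlinarith
    have hr : a * ι = b * k := by rw [ha, hb]; ring
    have := h a b hb0 (by nlinarith) hr.ge
    omega
  obtain ⟨u, v, huv⟩ := hcop
  have hn0 := Int.emod_nonneg (-u) (b := ι) (by omega)
  have hnι := Int.emod_lt_of_pos (-u) (b := ι) (by omega)
  have hdiv := Int.emod_add_mul_ediv (-u) ι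
  generalize (-u) % ι = n at *
  generalize (-u) / ι = q at *
  have hr : (v - q * k) * ι - n * k = 1 := by
    linear_combination huv - k * hdiv
  have hn : 0 < n := by
    rcases hn0.eq_or_lt with rfl | hn
    · have := Int.eq_one_of_dvd_one (by omega) (Dvd.intro_left (v - q * k) (by linarith) : ι ∣ 1)
      omega
    · exact hn
  have hlt := h (v - q * k) n hn hnι (by linarith)
  rw [hr] at hlt
  obtain rfl | rfl : n = 1 ∨ n = 2 := by omega
  · exact .inl ⟨v - q * k, by linarith⟩
  · exact .inr ⟨v - q * k, by linarith⟩

/-- The condition `2 k ≡ -1` modulo `ι`, solved for `k`. -/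
theorem dvd_two_mul_add_one_iff (k ι : ℤ) :
    ι ∣ 2 * k + 1 ↔ Odd ι ∧ Int.ModEq ι k ((ι - 1) / 2) := by
  constructor
  · intro h
    have hodd : Odd ι := by
      rw [← Int.not_even_iff_odd, even_iff_two_dvd]
      intro h2
      have := h2.trans h
      omega
    refine ⟨hodd, ?_⟩
    obtain ⟨c, rfl⟩ := hodd
    rw [show (2 * c + 1 - 1) / 2 = c by omega]
    refine (Int.modEq_iff_dvd.2 ?_).symm
    have hcop : IsCoprime (2 * c + 1) 2 := ⟨1, -c, by ring⟩
    refine hcop.dvd_of_dvd_mul_left ?_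
    convert dvd_sub h (dvd_refl (2 * c + 1)) using 1
    ring
  · rintro ⟨⟨c, rfl⟩, h⟩
    rw [show (2 * c + 1 - 1) / 2 = c by omega] at h
    obtain ⟨d, hd⟩ := h.symm.dvd
    exact ⟨2 * d + 1, by linear_combination 2 * hd⟩

/-- The rational polygon `conv((0,0), (k, ι), (k + 1/3, ι))` with `ι ≥ 2` is
canonical (its lattice points are exactly `(0,0)` and `(k,ι)`) if and only if
either `ι ∣ k + 1`, or `ι` is odd and `k ≡ (ι − 1)/2 (mod ι)`. -/
theorem canonical_third_cone (k ι : ℤ) (hι : 2 ≤ ι) :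
    convexHull ℚ ({((0 : ℚ), (0 : ℚ)), ((k : ℚ), (ι : ℚ)),
        ((k : ℚ) + 1 / 3, (ι : ℚ))} : Set (ℚ × ℚ)) ∩ intPts
      = {((0 : ℚ), (0 : ℚ)), ((k : ℚ), (ι : ℚ))} ↔
    (ι ∣ (k + 1) ∨ (Odd ι ∧ Int.ModEq ι k ((ι - 1) / 2))) := by
  rw [← dvd_two_mul_add_one_iff]
  constructor
  · intro h
    refine dvd_add_one_or_dvd_two_mul_add_one k ι hι fun m n hn hnι hle => ?_
    by_contra! hlt
    have hmem := h.subset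
      ⟨(intCast_mem_convexHull_third_cone_iff k ι m n (by omega)).2 ⟨hnι.le, hle, hlt⟩,
        mem_intPts_iff.2 ⟨m, n, rfl⟩⟩
    simp only [Set.mem_insert_iff, Set.mem_singleton_iff, Prod.mk.injEq, Int.cast_eq_zero,
      Int.cast_inj] at hmem
    omega
  · intro h
    refine Set.Subset.antisymm ?_ ?_
    · rintro _ ⟨hp, hint⟩
      obtain ⟨m, n, rfl⟩ := mem_intPts_iff.1 hint
      obtain ⟨h1, h2, h3⟩ := (intCast_mem_convexHull_third_cone_iff k ι m n (by omega)).1 hp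
      simp only [Set.mem_insert_iff, Set.mem_singleton_iff, Prod.mk.injEq, Int.cast_eq_zero,
        Int.cast_inj]
      obtain ⟨r, hr⟩ : ∃ r, r = m * ι - n * k := ⟨_, rfl⟩
      have hr0 : r = 0 := by
        by_contra hne
        rcases h with ⟨c, hc⟩ | ⟨c, hc⟩
        · have hdvd : ι ∣ n - r := ⟨n * c - m, by linear_combination n * hc - hr⟩
          have := Int.le_of_dvd (by omega) hdvd
          omega
        · have hdvd : ι ∣ n - 2 * r := ⟨n * c - 2 * m, by linear_combination n * hc - 2 * hr⟩
          have := Int.le_of_dvd (by omega) hdvd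
          omega
      have hn : ι ∣ n := by
        rcases h with ⟨c, hc⟩ | ⟨c, hc⟩
        · exact ⟨n * c - m, by linear_combination n * hc - hr + hr0⟩
        · exact ⟨n * c - 2 * m, by linear_combination n * hc - 2 * hr + 2 * hr0⟩
      rcases (show 0 ≤ n by omega).eq_or_lt with rfl | hpos
      · left
        have : m * ι = 0 := by linarith
        exact ⟨(mul_eq_zero.1 this).resolve_right (by omega), rfl⟩
      · right
        obtain rfl : n = ι := le_antisymm h1 (Int.le_of_dvd hpos hn)
        refine ⟨mul_right_cancel₀ (show n ≠ 0 by omega) ?_, rfl⟩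
        linarith
    · rintro _ (rfl | rfl)
      · exact ⟨subset_convexHull _ _ (by simp), mem_intPts_iff.2 ⟨0, 0, by simp⟩⟩
      · exact ⟨subset_convexHull _ _ (by simp), mem_intPts_iff.2 ⟨k, ι, rfl⟩⟩
end

section
/- Let k ∈ ℤ and ι ∈ ℤ with ι ≥ 2, and set P = conv((0,0), (k − 1/3, ι), (k + 1/3, ι)) ⊆ ℚ². Then P ∩ ℤ² = {(0,0), (k,ι)} (equivalently, P is canonical) if and only if either ι = 2 and k is odd, or ι = 3 and k ≡ 1 or 2 (mod 3). -/
/-- A lattice point lies in the cone triangle iff it satisfies the inequalities of its edges. -/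
theorem intCast_mem_convexHull_iff (k ι m n : ℤ) (hι : 0 < ι) :
    ((m : ℚ), (n : ℚ)) ∈ convexHull ℚ ({((0 : ℚ), (0 : ℚ)), ((k : ℚ) - 1 / 3, (ι : ℚ)),
        ((k : ℚ) + 1 / 3, (ι : ℚ))} : Set (ℚ × ℚ)) ↔
      n ≤ ι ∧ 3 * (ι * m - k * n) ≤ n ∧ -n ≤ 3 * (ι * m - k * n) := by
  have hι' : (0 : ℚ) < ι := by exact_mod_cast hι
  constructor
  · intro h
    rw [convexHull_insert (by simp), convexHull_pair] at h
    simp only [convexJoin_singleton_left, Set.mem_iUnion] at h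
    obtain ⟨q, ⟨b, c, hb, hc, hbc, rfl⟩, s, t, hs, ht, hst, h⟩ := h
    simp only [Prod.smul_mk, Prod.mk_add_mk, smul_eq_mul, Prod.mk.injEq, mul_zero,
      zero_add] at h
    obtain ⟨hm, hn⟩ := h
    obtain rfl : b = 1 - c := by linarith
    have hn' : (n : ℚ) = t * ι := by rw [← hn]; ring
    have hm' : (m : ℚ) = t * (k + (2 * c - 1) / 3) := by rw [← hm]; ring
    have htι : 0 ≤ t * (ι : ℚ) := by positivity
    have e : 3 * ((ι : ℚ) * m - k * n) = t * ι * (2 * c - 1) := by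
      rw [hn', hm']; ring
    refine ⟨?_, ?_, ?_⟩
    · have : (n : ℚ) ≤ ι := by rw [hn']; nlinarith
      exact_mod_cast this
    · have : 3 * ((ι : ℚ) * m - k * n) ≤ n := by rw [e, hn']; nlinarith
      exact_mod_cast this
    · have : -(n : ℚ) ≤ 3 * ((ι : ℚ) * m - k * n) := by rw [e, hn']; nlinarith
      exact_mod_cast this
  · rintro ⟨h1, h2, h3⟩
    have h1' : (n : ℚ) ≤ ι := by exact_mod_cast h1
    have h2' : 3 * ((ι : ℚ) * m - k * n) ≤ n := by exact_mod_cast h2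
    have h3' : -(n : ℚ) ≤ 3 * ((ι : ℚ) * m - k * n) := by exact_mod_cast h3
    set S : Set (ℚ × ℚ) := {((0 : ℚ), (0 : ℚ)), ((k : ℚ) - 1 / 3, (ι : ℚ)),
        ((k : ℚ) + 1 / 3, (ι : ℚ))} with hS
    have key := (convex_convexHull ℚ S).sum_mem (t := Finset.univ)
      (w := ![1 - (n : ℚ) / ι, (n - 3 * (ι * m - k * n)) / (2 * ι),
        (n + 3 * (ι * m - k * n)) / (2 * ι)])
      (z := ![((0 : ℚ), (0 : ℚ)), ((k : ℚ) - 1 / 3, (ι : ℚ)), ((k : ℚ) + 1 / 3, (ι : ℚ))])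
      (by
        intro i _
        fin_cases i
        · simpa using (div_le_one hι').2 h1'
        · exact div_nonneg (by linarith) (by positivity)
        · exact div_nonneg (by linarith) (by positivity))
      (by
        simp only [Fin.sum_univ_three, Matrix.cons_val]
        field_simp
        ring)
      (by
        intro i _
        apply subset_convexHull
        fin_cases i <;> simp [hS])
    convert key using 1
    simp only [Fin.sum_univ_three, Matrix.cons_val, Prod.smul_mk, Prod.mk_add_mk, smul_eq_mul,
      Prod.mk.injEq]
    constructor <;> field_simp <;> ring

/-- If `ι ≥ 4`, the cone triangle has a lattice point at some height strictly between
`0` and `ι`. -/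
theorem exists_interior_height_of_four_le (k ι : ℤ) (hι : 4 ≤ ι) :
    ∃ m n : ℤ, 0 < n ∧ n < ι ∧ 3 * (ι * m - k * n) ≤ n ∧ -n ≤ 3 * (ι * m - k * n) := by
  by_cases hg : IsCoprime k ι
  · obtain ⟨a, b, hab⟩ := hg
    have hdiv := Int.emod_add_mul_ediv a ι
    have hlt := Int.emod_lt_of_pos a (show 0 < ι by omega)
    have hnn := Int.emod_nonneg a (show ι ≠ 0 by omega)
    set n := a % ι
    set q := a / ι
    have e : ι * (-(b + q * k)) - k * n = -1 := by
      have : a = n + ι * q := hdiv.symm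
      rw [this] at hab
      linear_combination -hab
    by_cases hn : 3 ≤ n
    · exact ⟨-(b + q * k), n, by omega, hlt, by omega, by omega⟩
    · have e' : ι * (k + (b + q * k)) - k * (ι - n) = 1 := by linear_combination -e
      have hn0 : n ≠ 0 := by
        intro h0
        rw [h0] at e
        have : ι ∣ 1 := ⟨b + q * k, by linear_combination e⟩
        have := Int.le_of_dvd one_pos this
        omega
      have h3 : 3 ≤ ι - n := by
        by_contra hcon
        have h2 : n = 2 := by omega
        have h4 : ι = 4 := by omega
        rw [h2, h4] at e
        omega
      exact ⟨k + (b + q * k), ι - n, by omega, by omega, by omega, by omega⟩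
  · rw [Int.isCoprime_iff_gcd_eq_one] at hg
    obtain ⟨c, hc⟩ := Int.gcd_dvd_left k ι
    obtain ⟨d, hd⟩ := Int.gcd_dvd_right k ι
    have hg0 : Int.gcd k ι ≠ 0 := by
      intro h0
      rw [h0] at hd
      simp at hd
      omega
    have hg2 : (2 : ℤ) ≤ Int.gcd k ι := by omega
    generalize ((Int.gcd k ι : ℕ) : ℤ) = g at *
    have hd0 : 0 < d := by
      by_contra hcon
      nlinarith
    have e : ι * c - k * d = 0 := by
      rw [hc, hd]; ring
    refine ⟨c, d, hd0, by nlinarith, by omega, by omega⟩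

/-- The rational polygon `conv((0,0), (k − 1/3, ι), (k + 1/3, ι))` with `ι ≥ 2`
is canonical (its lattice points are exactly `(0,0)` and `(k,ι)`) if and only
if either `ι = 2` and `k` is odd, or `ι = 3` and `k ≡ 1, 2 (mod 3)`. -/
theorem canonical_thirdthird_cone (k ι : ℤ) (hι : 2 ≤ ι) :
    convexHull ℚ ({((0 : ℚ), (0 : ℚ)), ((k : ℚ) - 1 / 3, (ι : ℚ)),
        ((k : ℚ) + 1 / 3, (ι : ℚ))} : Set (ℚ × ℚ)) ∩ intPts
      = {((0 : ℚ), (0 : ℚ)), ((k : ℚ), (ι : ℚ))} ↔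
    ((ι = 2 ∧ Odd k) ∨ (ι = 3 ∧ (Int.ModEq 3 k 1 ∨ Int.ModEq 3 k 2))) := by
  have hpos : 0 < ι := by omega
  have reduce : convexHull ℚ ({((0 : ℚ), (0 : ℚ)), ((k : ℚ) - 1 / 3, (ι : ℚ)),
        ((k : ℚ) + 1 / 3, (ι : ℚ))} : Set (ℚ × ℚ)) ∩ intPts
      = {((0 : ℚ), (0 : ℚ)), ((k : ℚ), (ι : ℚ))} ↔
      ∀ m n : ℤ, 0 < n → n < ι →
        ¬ (3 * (ι * m - k * n) ≤ n ∧ -n ≤ 3 * (ι * m - k * n)) := by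
    constructor
    · rintro h m n h0 h1 ⟨h2, h3⟩
      have hmem : ((m : ℚ), (n : ℚ)) ∈ ({((0 : ℚ), (0 : ℚ)), ((k : ℚ), (ι : ℚ))} :
          Set (ℚ × ℚ)) := by
        rw [← h]
        exact ⟨(intCast_mem_convexHull_iff k ι m n hpos).2 ⟨h1.le, h2, h3⟩, m, n, rfl⟩
      simp only [Set.mem_insert_iff, Set.mem_singleton_iff, Prod.mk.injEq] at hmem
      norm_cast at hmem
      omega
    · intro h
      ext p
      constructor
      · rintro ⟨hp, m, n, rfl⟩
        obtain ⟨h1, h2, h3⟩ := (intCast_mem_convexHull_iff k ι m n hpos).1 hp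
        simp only [Set.mem_insert_iff, Set.mem_singleton_iff, Prod.mk.injEq]
        norm_cast
        rcases lt_trichotomy n 0 with hn | rfl | hn
        · omega
        · have : ι * m = 0 := by omega
          left
          exact ⟨(mul_eq_zero.1 this).resolve_left hpos.ne', rfl⟩
        · rcases h1.lt_or_eq with hlt | rfl
          · exact absurd ⟨h2, h3⟩ (h m n hn hlt)
          · right
            refine ⟨le_antisymm ?_ ?_, rfl⟩ <;> by_contra! hcon <;> nlinarith
      · rintro (rfl | rfl)
        · exact ⟨subset_convexHull ℚ _ (by simp), 0, 0, by simp⟩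
        · exact ⟨(intCast_mem_convexHull_iff k ι k ι hpos).2
            ⟨le_rfl, by linarith [mul_comm ι k], by linarith [mul_comm ι k]⟩, k, ι, rfl⟩
  rw [reduce]
  constructor
  · intro h
    have hlt : ι < 4 := by
      by_contra! h4
      obtain ⟨m, n, h0, h1, h23⟩ := exists_interior_height_of_four_le k ι h4
      exact h m n h0 h1 h23
    have hk := h (k / ι) 1 one_pos (by omega)
    obtain rfl | rfl : ι = 2 ∨ ι = 3 := by omega
    · left
      exact ⟨rfl, Int.odd_iff.2 (by omega)⟩
    · right
      refine ⟨rfl, ?_⟩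
      simp only [Int.ModEq]
      omega
  · rintro (⟨rfl, hk⟩ | ⟨rfl, hk⟩) m n h0 h1 ⟨h2, h3⟩
    · rw [Int.odd_iff] at hk
      obtain rfl : n = 1 := by omega
      omega
    · simp only [Int.ModEq] at hk
      obtain rfl | rfl : n = 1 ∨ n = 2 := by omega
      all_goals omega
end

section
/- Let k ∈ ℤ and ι ∈ ℤ with ι ≥ 2, and set P = conv((0,0), (k + 1/2, ι), (k + 4/5, ι)) ⊆ ℚ². Then P contains no lattice points other than (0,0), i.e. P ∩ ℤ² = {(0,0)}, if and only if P is lattice equivalent to one of the following polytopes: conv((0,0), (−1/2, ι), (−1/5, ι)); conv((0,0), (1/2, ι), (4/5, ι)); or, only in case 2 divides ι, conv((0,0), (ι/2 − 1/2, ι), (ι/2 − 1/5, ι)). -/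
/-- Membership in the triangle with apex at the origin and horizontal opposite side. -/
lemma mem_convexHull_triangle {x₁ x₂ h : ℚ} (hx : x₁ < x₂) (hh : 0 < h) (p : ℚ × ℚ) :
    p ∈ convexHull ℚ ({(0, 0), (x₁, h), (x₂, h)} : Set (ℚ × ℚ)) ↔
      0 ≤ p.2 ∧ p.2 ≤ h ∧ x₁ * p.2 ≤ p.1 * h ∧ p.1 * h ≤ x₂ * p.2 := by
  constructor
  · have hconv : Convex ℚ {p : ℚ × ℚ |
        0 ≤ p.2 ∧ p.2 ≤ h ∧ x₁ * p.2 ≤ p.1 * h ∧ p.1 * h ≤ x₂ * p.2} := by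
      rintro ⟨x, y⟩ ⟨h1, h2, h3, h4⟩ ⟨x', y'⟩ ⟨h1', h2', h3', h4'⟩ a b ha hb hab
      simp only [Set.mem_ofPred_eq, Prod.smul_mk, Prod.mk_add_mk, smul_eq_mul] at *
      have e : h = a * h + b * h := by rw [← add_mul, hab, one_mul]
      refine ⟨by positivity, ?_, ?_, ?_⟩
      · rw [e]; gcongr
      · linarith [mul_le_mul_of_nonneg_left h3 ha, mul_le_mul_of_nonneg_left h3' hb]
      · linarith [mul_le_mul_of_nonneg_left h4 ha, mul_le_mul_of_nonneg_left h4' hb]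
    refine fun hp => convexHull_min ?_ hconv hp
    rintro q (rfl | rfl | rfl)
    · simp [hh.le]
    · simp only [Set.mem_ofPred_eq]
      exact ⟨hh.le, le_rfl, le_rfl, by gcongr⟩
    · simp only [Set.mem_ofPred_eq]
      exact ⟨hh.le, le_rfl, by gcongr, le_rfl⟩
  · obtain ⟨x, y⟩ := p
    rintro ⟨h1, h2, h3, h4⟩
    simp only at h1 h2 h3 h4
    have hC := convex_convexHull ℚ ({(0, 0), (x₁, h), (x₂, h)} : Set (ℚ × ℚ))
    have m0 : ((0, 0) : ℚ × ℚ) ∈ convexHull ℚ ({(0, 0), (x₁, h), (x₂, h)} : Set (ℚ × ℚ)) :=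
      subset_convexHull _ _ (by simp)
    have m1 : (x₁, h) ∈ convexHull ℚ ({(0, 0), (x₁, h), (x₂, h)} : Set (ℚ × ℚ)) :=
      subset_convexHull _ _ (by simp)
    have m2 : (x₂, h) ∈ convexHull ℚ ({(0, 0), (x₁, h), (x₂, h)} : Set (ℚ × ℚ)) :=
      subset_convexHull _ _ (by simp)
    rcases h1.eq_or_lt with rfl | hy
    · have hx0 : x = 0 := by
        have : x * h = 0 := by linarith
        simpa [hh.ne'] using this
      rw [hx0]; exact m0
    have hd : 0 < x₂ - x₁ := sub_pos.2 hx
    have hz := hC m1 m2 (a := (x₂ * y - x * h) / (y * (x₂ - x₁)))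
      (b := (x * h - x₁ * y) / (y * (x₂ - x₁)))
      (div_nonneg (by linarith) (by positivity)) (div_nonneg (by linarith) (by positivity))
      (by field_simp; ring)
    have := hC.smul_mem_of_zero_mem m0 hz (t := y / h)
      ⟨by positivity, by rw [div_le_one hh]; exact h2⟩
    convert this using 1
    ext
    · simp; field_simp; ring
    · simp; field_simp; ring

/-- A horizontal shear by an integer is a lattice equivalence. -/
lemma latticeEquiv_shear (m : ℤ) (x₁ x₂ h : ℚ) :
    LatticeEquiv (convexHull ℚ ({(0, 0), (x₁, h), (x₂, h)} : Set (ℚ × ℚ)))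
      (convexHull ℚ ({(0, 0), (x₁ + m * h, h), (x₂ + m * h, h)} : Set (ℚ × ℚ))) := by
  refine ⟨1, m, 0, 1, 0, 0, by norm_num, ?_⟩
  have hlin : IsLinearMap ℚ (fun p : ℚ × ℚ => (p.1 + m * p.2, p.2)) :=
    ⟨fun p q => by ext <;> simp; ring, fun c p => by ext <;> simp; ring⟩
  have := hlin.image_convexHull ({(0, 0), (x₁, h), (x₂, h)} : Set (ℚ × ℚ))
  simpa [Set.image_insert_eq] using this.symm

/-- If `S'` has the origin as its only lattice point and `S` is lattice equivalent to `S'`,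
then the origin is the only lattice point of `S`, provided it lies in `S`. -/
lemma LatticeEquiv.inter_intPts_eq {S S' : Set (ℚ × ℚ)} (h : LatticeEquiv S S')
    (h0 : (0, 0) ∈ S) (hS' : S' ∩ intPts ⊆ {(0, 0)}) : S ∩ intPts = {(0, 0)} := by
  obtain ⟨a, b, c, d, w1, w2, hdet, rfl⟩ := h
  have key : ∀ m n : ℤ, ((m : ℚ), (n : ℚ)) ∈ S → a * m + b * n + w1 = 0 ∧ c * m + d * n + w2 = 0 := by
    intro m n hmn
    have := hS' ⟨⟨_, hmn, rfl⟩, a * m + b * n + w1, c * m + d * n + w2, by push_cast; rfl⟩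
    simp only [Set.mem_singleton_iff, Prod.mk.injEq] at this
    exact_mod_cast this
  have k0 := key 0 0 (by simpa using h0)
  refine Set.Subset.antisymm ?_ ?_
  · rintro _ ⟨hp, m, n, rfl⟩
    have k1 := key m n hp
    have e1 : a * m + b * n = 0 := by linarith
    have e2 : c * m + d * n = 0 := by linarith
    have f1 : (a * d - b * c) * m = 0 := by linear_combination d * e1 - b * e2
    have f2 : (a * d - b * c) * n = 0 := by linear_combination a * e2 - c * e1
    have hne : a * d - b * c ≠ 0 := by omega
    have g1 : m = 0 := (mul_eq_zero.1 f1).resolve_left hne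
    have g2 : n = 0 := (mul_eq_zero.1 f2).resolve_left hne
    simp [g1, g2]
  · rintro _ rfl
    exact ⟨h0, 0, 0, by simp⟩

/-- An interval `[s / t, s' / t']` containing no fraction with denominator at most `N` lies
strictly between two neighbours `a / q < b / q'` with `q + q' > N`. -/
lemma exists_farey_neighbours {s t s' t' N : ℤ}
    (hfree : ∀ j n : ℤ, 1 ≤ j → j ≤ N → s * j ≤ t * n → t' * n ≤ s' * j → False) :
    ∀ (f : ℕ) (a b q q' : ℤ), N < q + q' + f → 1 ≤ q → 1 ≤ q' → b * q - a * q' = 1 →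
      t * a < s * q → s' * q' < t' * b →
      ∃ a b q q' : ℤ, N < q + q' ∧ 1 ≤ q ∧ 1 ≤ q' ∧ b * q - a * q' = 1 ∧
        t * a < s * q ∧ s' * q' < t' * b
  | 0, a, b, q, q', hN, h1, h2, h3, h4, h5 => ⟨a, b, q, q', by simpa using hN, h1, h2, h3, h4, h5⟩
  | f + 1, a, b, q, q', hN, h1, h2, h3, h4, h5 => by
    push_cast at hN
    by_cases hlt : N < q + q'
    · exact ⟨a, b, q, q', hlt, h1, h2, h3, h4, h5⟩
    by_cases hl : s * (q + q') ≤ t * (a + b)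
    · have hr : s' * (q + q') < t' * (a + b) := by
        by_contra! hr
        exact hfree _ _ (by omega) (by omega) hl hr
      exact exists_farey_neighbours hfree f a (a + b) q (q + q') (by omega) h1 (by omega)
        (by linarith) h4 hr
    · exact exists_farey_neighbours hfree f (a + b) b (q + q') q' (by omega) (by omega) h2
        (by linarith) (not_le.1 hl) h5

lemma small_height_cases : ∀ i < 18, ∀ r < i, r = 0 ∨ r + 1 = i ∨ 2 * r + 2 = i ∨
    ∃ j < i + 1, ∃ n < i + 1, 0 < j ∧ (2 * r + 1) * j ≤ 2 * i * n ∧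
      5 * i * n ≤ (5 * r + 4) * j := by
  decide +kernel

/-- Classification of the residues of `k` modulo the height `i` for which
the triangle is free of lattice points. -/
lemma residue_of_free {k i : ℤ} (hi : 2 ≤ i)
    (hfree : ∀ j n : ℤ, 1 ≤ j → j ≤ i → (2 * k + 1) * j ≤ (2 * i) * n →
      (5 * i) * n ≤ (5 * k + 4) * j → False) :
    (∃ m, k = m * i) ∨ (∃ m, k + 1 = m * i) ∨ (∃ m, 2 * (k + 1) = (2 * m + 1) * i) := by
  rcases lt_or_ge i 18 with hsmall | hlarge
  · have hr0 := Int.emod_nonneg k (show i ≠ 0 by omega)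
    have hr1 := Int.emod_lt_of_pos k (show 0 < i by omega)
    have hk := Int.emod_add_mul_ediv k i
    set r := k % i
    set m := k / i
    lift i to ℕ using by omega with i'
    lift r to ℕ using hr0 with r'
    rcases small_height_cases i' (by omega) r' (by omega) with h | h | h | ⟨j, hj, n, -, hj0, h1, h2⟩
    · left; exact ⟨m, by rw [← hk, h]; push_cast; ring⟩
    · right; left; exact ⟨m + 1, by rw [← hk, ← h]; push_cast; ring⟩
    · right; right; exact ⟨m, by rw [← hk, ← h]; push_cast; ring⟩
    · zify at h1 h2
      refine (hfree j (n + m * j) (by omega) (by omega) ?_ ?_).elim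
      · rw [← hk]; linarith
      · rw [← hk]; linarith
  · have hfl := Int.emod_nonneg (5 * k + 4) (show 5 * i ≠ 0 by omega)
    have hfl' := Int.emod_lt_of_pos (5 * k + 4) (show 0 < 5 * i by omega)
    have hfl'' := Int.emod_add_mul_ediv (5 * k + 4) (5 * i)
    set a₀ := (5 * k + 4) / (5 * i)
    obtain ⟨a, b, q, q', hN, hq, hq', hdet, hL, hR⟩ :=
      exists_farey_neighbours hfree i.toNat a₀ (a₀ + 1) 1 1 (by omega) le_rfl le_rfl (by ring)
        (by
          by_contra! h
          exact hfree 1 a₀ le_rfl (by omega) h (by linarith))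
        (by linarith)
    obtain ⟨u, hu⟩ : ∃ u, u = a * i - k * q := ⟨_, rfl⟩
    obtain ⟨v, hv⟩ : ∃ v, v = (k + 1) * q' - b * i := ⟨_, rfl⟩
    have hu2 : 2 * u < q := by linarith
    have hv5 : 5 * v < q' := by linarith
    have hrel : u * q' + v * q = q * q' - i := by
      rw [hu, hv]; linear_combination (-i) * hdet
    have hu0 : 0 ≤ u := by
      by_contra! hneg
      have hb : 1 ≤ b * i - k * q' := by linarith
      have e : i = q * (b * i - k * q') + q' * (-u) := by
        rw [hu]; linear_combination (-i) * hdet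
      have := mul_le_mul_of_nonneg_left hb (show 0 ≤ q by omega)
      have := mul_le_mul_of_nonneg_left (show 1 ≤ -u by omega) (show 0 ≤ q' by omega)
      linarith
    have hv0 : 0 ≤ v := by
      by_contra! hneg
      have hb : 1 ≤ (k + 1) * q - a * i := by linarith
      have e : i = q' * ((k + 1) * q - a * i) + q * (-v) := by
        rw [hv]; linear_combination (-i) * hdet
      have := mul_le_mul_of_nonneg_left hb (show 0 ≤ q' by omega)
      have := mul_le_mul_of_nonneg_left (show 1 ≤ -v by omega) (show 0 ≤ q by omega)
      linarith
    have hprod : 3 * (q * q') < 10 * i := by nlinarith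
    rcases lt_or_ge q 4 with hq4 | hq4
    · obtain rfl | rfl | rfl : q = 1 ∨ q = 2 ∨ q = 3 := by omega
      · obtain rfl : u = 0 := by omega
        exact Or.inl ⟨a, by linarith⟩
      · obtain rfl : u = 0 := by omega
        omega
      · obtain rfl | rfl : u = 0 ∨ u = 1 := by omega
        · omega
        · omega
    rcases lt_or_ge q' 4 with hq4' | hq4'
    · obtain rfl : v = 0 := by omega
      obtain rfl | rfl | rfl : q' = 1 ∨ q' = 2 ∨ q' = 3 := by omega
      · exact Or.inr (Or.inl ⟨b, by linarith⟩)
      · have hodd : Odd (b * q) := ⟨a, by linarith⟩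
        obtain ⟨m, rfl⟩ := (Int.odd_mul.1 hodd).1
        exact Or.inr (Or.inr ⟨m, by linarith⟩)
      · omega
    · nlinarith [mul_nonneg (sub_nonneg.2 hq4) (sub_nonneg.2 hq4')]

/-- The rational polygon `P = conv((0,0), (k + 1/2, ι), (k + 4/5, ι))` with
`ι ≥ 2` contains no lattice points other than `(0,0)` if and only if it is
lattice equivalent to `conv((0,0), (−1/2,ι), (−1/5,ι))`, to
`conv((0,0), (1/2,ι), (4/5,ι))`, or — only in case `2 ∣ ι` — to
`conv((0,0), (ι/2 − 1/2, ι), (ι/2 − 1/5, ι))`. -/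
theorem lattice_point_free_half_fourfifths (k ι : ℤ) (hι : 2 ≤ ι) :
    (convexHull ℚ ({((0 : ℚ), (0 : ℚ)), ((k : ℚ) + 1 / 2, (ι : ℚ)),
        ((k : ℚ) + 4 / 5, (ι : ℚ))} : Set (ℚ × ℚ)) ∩ intPts
      = {((0 : ℚ), (0 : ℚ))}) ↔
    (LatticeEquiv
        (convexHull ℚ ({((0 : ℚ), (0 : ℚ)), ((k : ℚ) + 1 / 2, (ι : ℚ)),
          ((k : ℚ) + 4 / 5, (ι : ℚ))} : Set (ℚ × ℚ)))
        (convexHull ℚ ({((0 : ℚ), (0 : ℚ)), ((-1 / 2 : ℚ), (ι : ℚ)),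
          ((-1 / 5 : ℚ), (ι : ℚ))} : Set (ℚ × ℚ))) ∨
      LatticeEquiv
        (convexHull ℚ ({((0 : ℚ), (0 : ℚ)), ((k : ℚ) + 1 / 2, (ι : ℚ)),
          ((k : ℚ) + 4 / 5, (ι : ℚ))} : Set (ℚ × ℚ)))
        (convexHull ℚ ({((0 : ℚ), (0 : ℚ)), ((1 / 2 : ℚ), (ι : ℚ)),
          ((4 / 5 : ℚ), (ι : ℚ))} : Set (ℚ × ℚ))) ∨
      (2 ∣ ι ∧
        LatticeEquiv
          (convexHull ℚ ({((0 : ℚ), (0 : ℚ)), ((k : ℚ) + 1 / 2, (ι : ℚ)),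
            ((k : ℚ) + 4 / 5, (ι : ℚ))} : Set (ℚ × ℚ)))
          (convexHull ℚ ({((0 : ℚ), (0 : ℚ)), ((ι : ℚ) / 2 - 1 / 2, (ι : ℚ)),
            ((ι : ℚ) / 2 - 1 / 5, (ι : ℚ))} : Set (ℚ × ℚ))))) := by
  have hi : (2 : ℚ) ≤ ι := by exact_mod_cast hι
  have hpos : (0 : ℚ) < ι := by linarith
  have h0 : ((0, 0) : ℚ × ℚ) ∈ convexHull ℚ ({((0 : ℚ), (0 : ℚ)), ((k : ℚ) + 1 / 2, (ι : ℚ)),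
      ((k : ℚ) + 4 / 5, (ι : ℚ))} : Set (ℚ × ℚ)) := subset_convexHull _ _ (by simp)
  constructor
  · intro h
    have hres := residue_of_free (k := k) hι (by
      intro j n hj hji hl hr
      have hj' : (1 : ℚ) ≤ j := by exact_mod_cast hj
      have hji' : (j : ℚ) ≤ ι := by exact_mod_cast hji
      have hl' : (2 * (k : ℚ) + 1) * j ≤ (2 * ι) * n := by exact_mod_cast hl
      have hr' : (5 * (ι : ℚ)) * n ≤ (5 * k + 4) * j := by exact_mod_cast hr
      have hmem := h.subset ⟨(mem_convexHull_triangle (by linarith) hpos ((n : ℚ), (j : ℚ))).2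
        ⟨by dsimp only; linarith, hji', by dsimp only; linarith, by dsimp only; linarith⟩,
        n, j, rfl⟩
      simp only [Set.mem_singleton_iff, Prod.mk.injEq] at hmem
      linarith [hmem.2])
    obtain ⟨m, hm⟩ | ⟨m, hm⟩ | ⟨m, hm⟩ := hres
    · right; left
      have hm' : (k : ℚ) = m * ι := by exact_mod_cast hm
      convert latticeEquiv_shear (-m) (k + 1 / 2) (k + 4 / 5) ι using 6 <;>
        (rw [hm']; push_cast; ring_nf)
    · left
      have hm' : (k : ℚ) + 1 = m * ι := by exact_mod_cast hm
      convert latticeEquiv_shear (-m) (k + 1 / 2) (k + 4 / 5) ι using 6 <;>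
        (rw [eq_sub_of_add_eq hm']; push_cast; ring_nf)
    · right; right
      have hm' : 2 * ((k : ℚ) + 1) = (2 * m + 1) * ι := by exact_mod_cast hm
      refine ⟨⟨k + 1 - m * ι, by linarith⟩, ?_⟩
      convert latticeEquiv_shear (-m) (k + 1 / 2) (k + 4 / 5) ι using 6 <;>
        (rw [show (k : ℚ) = (2 * m + 1) * ι / 2 - 1 by linarith]; push_cast; ring_nf)
  · rintro (h | h | ⟨⟨c, rfl⟩, h⟩) <;> refine h.inter_intPts_eq h0 ?_
    · rintro _ ⟨hp, n, j, rfl⟩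
      obtain ⟨h1, h2, h3, h4⟩ := (mem_convexHull_triangle (by norm_num) hpos _).1 hp
      dsimp only at h1 h2 h3 h4
      have g1 : 0 ≤ j := by exact_mod_cast h1
      have g2 : j ≤ ι := by exact_mod_cast h2
      have g3 : -j ≤ 2 * (n * ι) := by
        have : -j ≤ 2 * ((n : ℚ) * ι) := by linarith
        exact_mod_cast this
      have g4 : 5 * (n * ι) ≤ -j := by
        have : 5 * ((n : ℚ) * ι) ≤ -j := by linarith
        exact_mod_cast this
      rcases g1.eq_or_lt with rfl | hj
      · obtain rfl : n = 0 := by nlinarith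
        simp
      · have : n < 0 := by nlinarith
        nlinarith
    · rintro _ ⟨hp, n, j, rfl⟩
      obtain ⟨h1, h2, h3, h4⟩ := (mem_convexHull_triangle (by norm_num) hpos _).1 hp
      dsimp only at h1 h2 h3 h4
      have g1 : 0 ≤ j := by exact_mod_cast h1
      have g2 : j ≤ ι := by exact_mod_cast h2
      have g3 : j ≤ 2 * (n * ι) := by
        have : j ≤ 2 * ((n : ℚ) * ι) := by linarith
        exact_mod_cast this
      have g4 : 5 * (n * ι) ≤ 4 * j := by
        have : 5 * ((n : ℚ) * ι) ≤ 4 * j := by linarith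
        exact_mod_cast this
      rcases g1.eq_or_lt with rfl | hj
      · obtain rfl : n = 0 := by nlinarith
        simp
      · have : 0 < n := by nlinarith
        nlinarith
    · rintro _ ⟨hp, n, j, rfl⟩
      obtain ⟨h1, h2, h3, h4⟩ := (mem_convexHull_triangle (by linarith) hpos _).1 hp
      dsimp only at h1 h2 h3 h4
      push_cast at h2 h3 h4
      have g1 : 0 ≤ j := by exact_mod_cast h1
      have g2 : j ≤ 2 * c := by
        have : (j : ℚ) ≤ 2 * (c : ℚ) := by linarith
        exact_mod_cast this
      have g3 : 2 * c * (j - 2 * n) ≤ j := by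
        have : 2 * c * (j - 2 * (n : ℚ)) ≤ j := by linarith
        exact_mod_cast this
      have g4 : j ≤ 5 * c * (j - 2 * n) := by
        have : j ≤ 5 * c * (j - 2 * (n : ℚ)) := by linarith
        exact_mod_cast this
      rcases g1.eq_or_lt with rfl | hj
      · obtain rfl : n = 0 := by nlinarith
        simp
      · have d1 : 0 < j - 2 * n := by nlinarith
        have d2 : j - 2 * n < 2 := by nlinarith
        have hj' : 2 * c ≤ j := by nlinarith
        omega
end

section
/- Let i, j ∈ ℤ with i ≠ j and let k ∈ ℤ with k ≥ 0, and set P = conv((0,0), (i, k + 1/2), (j, k + 1/2)) ⊆ ℚ². Then P contains no lattice points other than (0,0), i.e. P ∩ ℤ² = {(0,0)}, if and only if k = 0. -/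
/-- The triangle at height `1 / 2` lies in a cone `|x| ≤ C * y` cut at height `1 / 2`, and the origin
is the only lattice point there. -/
lemma eq_zero_of_mem_convexHull_of_mem_intPts {a b : ℚ} {p : ℚ × ℚ}
    (hp : p ∈ convexHull ℚ ({((0 : ℚ), (0 : ℚ)), (a, 1 / 2), (b, 1 / 2)} : Set (ℚ × ℚ)))
    (hl : p ∈ intPts) : p = (0, 0) := by
  have hconv : Convex ℚ {q : ℚ × ℚ | q.1 ≤ 2 * (|a| + |b|) * q.2 ∧
      -q.1 ≤ 2 * (|a| + |b|) * q.2 ∧ 0 ≤ q.2 ∧ q.2 ≤ 1 / 2} := by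
    rintro x ⟨hx₁, hx₂, hx₀, hx₃⟩ y ⟨hy₁, hy₂, hy₀, hy₃⟩ s t hs ht hst
    simp only [Set.mem_ofPred_eq, Prod.fst_add, Prod.snd_add, Prod.smul_fst, Prod.smul_snd,
      smul_eq_mul]
    refine ⟨?_, ?_, by positivity, ?_⟩
    · linarith [mul_le_mul_of_nonneg_left hx₁ hs, mul_le_mul_of_nonneg_left hy₁ ht]
    · linarith [mul_le_mul_of_nonneg_left hx₂ hs, mul_le_mul_of_nonneg_left hy₂ ht]
    · linarith [mul_le_mul_of_nonneg_left hx₃ hs, mul_le_mul_of_nonneg_left hy₃ ht]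
  have hp' := convexHull_min (t := {q : ℚ × ℚ | q.1 ≤ 2 * (|a| + |b|) * q.2 ∧
      -q.1 ≤ 2 * (|a| + |b|) * q.2 ∧ 0 ≤ q.2 ∧ q.2 ≤ 1 / 2}) (by
    rintro q (rfl | rfl | rfl)
    · norm_num
    · refine ⟨?_, ?_, by norm_num, le_rfl⟩ <;>
        linarith [le_abs_self a, neg_abs_le a, abs_nonneg b]
    · refine ⟨?_, ?_, by norm_num, le_rfl⟩ <;>
        linarith [le_abs_self b, neg_abs_le b, abs_nonneg a]) hconv hp
  obtain ⟨m, n, rfl⟩ := hl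
  obtain ⟨h₁, h₂, h₀, h₃⟩ := hp'
  simp only at h₁ h₂ h₀ h₃
  have hn₀ : 0 ≤ n := by exact_mod_cast h₀
  have hn₁ : n < 1 := by exact_mod_cast h₃.trans_lt (by norm_num : (1 / 2 : ℚ) < 1)
  obtain rfl : n = 0 := by lia
  simp only [Int.cast_zero, mul_zero] at h₁ h₂
  ext
  · exact le_antisymm h₁ (neg_nonpos.1 h₂)
  · simp

/-- A point at height `y ≤ h` lies in the triangle with apex `0` and base `[a, b] × {h}` when the
ray from the apex through it meets the base. -/
lemma mem_convexHull_triangle_s13 {a b h x y : ℚ} (hab : a < b) (hh : 0 < h) (hy : 0 < y)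
    (hyh : y ≤ h) (hax : a * y ≤ x * h) (hxb : x * h ≤ b * y) :
    (x, y) ∈ convexHull ℚ ({((0 : ℚ), (0 : ℚ)), (a, h), (b, h)} : Set (ℚ × ℚ)) := by
  have hconv := convex_convexHull ℚ ({((0 : ℚ), (0 : ℚ)), (a, h), (b, h)} : Set (ℚ × ℚ))
  have h₀ := subset_convexHull ℚ ({((0 : ℚ), (0 : ℚ)), (a, h), (b, h)} : Set (ℚ × ℚ))
    (show ((0 : ℚ), (0 : ℚ)) ∈ _ by simp)
  have h₁ := subset_convexHull ℚ ({((0 : ℚ), (0 : ℚ)), (a, h), (b, h)} : Set (ℚ × ℚ))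
    (show (a, h) ∈ _ by simp)
  have h₂ := subset_convexHull ℚ ({((0 : ℚ), (0 : ℚ)), (a, h), (b, h)} : Set (ℚ × ℚ))
    (show (b, h) ∈ _ by simp)
  have hba : 0 < b - a := sub_pos.2 hab
  have hq : (x * h / y, h) ∈
      convexHull ℚ ({((0 : ℚ), (0 : ℚ)), (a, h), (b, h)} : Set (ℚ × ℚ)) := by
    convert hconv h₁ h₂ (a := (b - x * h / y) / (b - a)) (b := (x * h / y - a) / (b - a))
      (div_nonneg (sub_nonneg.2 ((div_le_iff₀ hy).2 hxb)) hba.le)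
      (div_nonneg (sub_nonneg.2 ((le_div_iff₀ hy).2 hax)) hba.le)
      (by field_simp; ring) using 1
    ext <;> simp <;> field_simp <;> ring
  convert hconv h₀ hq (a := 1 - y / h) (b := y / h)
    (sub_nonneg.2 ((div_le_one hh).2 hyh)) (by positivity) (by ring) using 1
  ext <;> simp <;> field_simp

/-- Among the `2 * k + 1` consecutive integers starting at `2 * k * i` one is divisible by
`2 * k + 1`; it gives a lattice point of the triangle at height `k`. -/
lemma exists_int_mem_convexHull {i j k : ℤ} (hij : i < j) (hk : 0 < k) :
    ∃ m : ℤ, ((m : ℚ), (k : ℚ)) ∈ convexHull ℚ ({((0 : ℚ), (0 : ℚ)), ((i : ℚ), (k : ℚ) + 1 / 2),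
      ((j : ℚ), (k : ℚ) + 1 / 2)} : Set (ℚ × ℚ)) := by
  have hk' : (0 : ℚ) < k := by exact_mod_cast hk
  have hd : 0 < 2 * k + 1 := by lia
  have hdiv := Int.mul_ediv_add_emod (2 * k * i + 2 * k) (2 * k + 1)
  have hmod := Int.emod_nonneg (2 * k * i + 2 * k) hd.ne'
  have hmod' := Int.emod_lt_of_pos (2 * k * i + 2 * k) hd
  set m := (2 * k * i + 2 * k) / (2 * k + 1)
  have hl : 2 * k * i ≤ (2 * k + 1) * m := by linarith
  have hu : (2 * k + 1) * m ≤ 2 * k * j := by nlinarith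
  have hl' : 2 * (k : ℚ) * i ≤ (2 * k + 1) * m := by exact_mod_cast hl
  have hu' : (2 * (k : ℚ) + 1) * m ≤ 2 * k * j := by exact_mod_cast hu
  exact ⟨m, mem_convexHull_triangle_s13 (by exact_mod_cast hij) (by positivity) hk' (by linarith)
    (by linarith) (by linarith)⟩

/-- The rational polygon `conv((0,0), (i, k + 1/2), (j, k + 1/2))` with
`i ≠ j` integers and `k ≥ 0` contains no lattice points other than `(0,0)` if
and only if `k = 0`. -/
theorem lattice_point_free_half_height (i j : ℤ) (hij : i ≠ j) (k : ℤ) (hk : 0 ≤ k) :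
    convexHull ℚ ({((0 : ℚ), (0 : ℚ)), ((i : ℚ), (k : ℚ) + 1 / 2),
        ((j : ℚ), (k : ℚ) + 1 / 2)} : Set (ℚ × ℚ)) ∩ intPts
      = {((0 : ℚ), (0 : ℚ))} ↔ k = 0 := by
  constructor
  · intro h
    by_contra hk₀
    obtain ⟨m, hm⟩ : ∃ m : ℤ, ((m : ℚ), (k : ℚ)) ∈ convexHull ℚ ({((0 : ℚ), (0 : ℚ)),
        ((i : ℚ), (k : ℚ) + 1 / 2), ((j : ℚ), (k : ℚ) + 1 / 2)} : Set (ℚ × ℚ)) := by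
      rcases hij.lt_or_gt with hlt | hgt
      · exact exists_int_mem_convexHull hlt (by lia)
      · rw [Set.pair_comm]
        exact exists_int_mem_convexHull hgt (by lia)
    have hmem := h.subset ⟨hm, m, k, rfl⟩
    simp only [Set.mem_singleton_iff, Prod.mk.injEq, Int.cast_eq_zero] at hmem
    exact hk₀ hmem.2
  · rintro rfl
    refine Set.Subset.antisymm ?_ ?_
    · rintro p ⟨hp, hl⟩
      exact eq_zero_of_mem_convexHull_of_mem_intPts (by simpa using hp) hl
    · rintro _ rfl
      exact ⟨subset_convexHull ℚ _ (by simp), 0, 0, by simp⟩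
end

section
/- Let a, b ∈ ℤ and ι ∈ ℤ with ι ≥ 2, and set P = conv((0,0,0), (a,b,ι), (a+1,b,ι), (a,b+1,ι), (a+1,b+1,ι)) ⊆ ℚ³. Then P is not canonical: there exists a lattice point p ∈ P ∩ ℤ³ with p ≠ 0 whose third coordinate satisfies 0 < p₃ < ι. Equivalently, the polytope conv(0, (a,b,ι), (a+1,b,ι), (a,b+1,ι), (a+1,b+1,ι)) is canonical only for ι = 1. -/
/-- The polytope `conv(0, (a,b,ι), (a+1,b,ι), (a,b+1,ι), (a+1,b+1,ι)) ⊆ ℚ³`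
with `ι ≥ 2` is not canonical: it contains a nonzero lattice point whose third
coordinate lies strictly between `0` and `ι`. -/
theorem quadrangle_not_canonical (a b ι : ℤ) (hι : 2 ≤ ι) :
    ∃ m n l : ℤ,
      (![(m : ℚ), (n : ℚ), (l : ℚ)] : Fin 3 → ℚ) ∈
        convexHull ℚ ({![0, 0, 0], ![(a : ℚ), (b : ℚ), (ι : ℚ)],
          ![(a : ℚ) + 1, (b : ℚ), (ι : ℚ)], ![(a : ℚ), (b : ℚ) + 1, (ι : ℚ)],
          ![(a : ℚ) + 1, (b : ℚ) + 1, (ι : ℚ)]} : Set (Fin 3 → ℚ)) ∧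
      ¬(m = 0 ∧ n = 0 ∧ l = 0) ∧ 0 < l ∧ l < ι := by
  have hι0 : (0 : ℚ) < ι := by exact_mod_cast (by omega : (0 : ℤ) < ι)
  have hι1 : (0 : ℚ) < (ι : ℚ) - 1 := by
    have : (1 : ℚ) < ι := by exact_mod_cast (by omega : (1 : ℤ) < ι)
    linarith
  have residue (c : ℤ) : ∃ x : ℚ, 0 ≤ x ∧ x ≤ 1 ∧
      ((c - c / ι : ℤ) : ℚ) = ((ι : ℚ) - 1) / ι * (c + x) := by
    have hlow : (0 : ℚ) ≤ (c % ι : ℤ) := by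
      exact_mod_cast Int.emod_nonneg c (by omega)
    have hup : ((c % ι : ℤ) : ℚ) ≤ ι - 1 := by
      have := Int.emod_lt_of_pos c (by omega : 0 < ι)
      exact_mod_cast (by omega : c % ι ≤ ι - 1)
    have hdiv : (ι : ℚ) * (c / ι : ℤ) + (c % ι : ℤ) = c := by
      exact_mod_cast Int.mul_ediv_add_emod c ι
    refine ⟨(c % ι : ℤ) / ((ι : ℚ) - 1), by positivity, (div_le_one hι1).2 hup, ?_⟩
    rw [Int.cast_sub]
    field_simp
    linarith
  obtain ⟨x, hx0, hx1, hx⟩ := residue a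
  obtain ⟨y, hy0, hy1, hy⟩ := residue b
  refine ⟨a - a / ι, b - b / ι, ι - 1, ?_, by omega, by omega, by omega⟩
  set S : Set (Fin 3 → ℚ) := {![0, 0, 0], ![(a : ℚ), (b : ℚ), (ι : ℚ)],
    ![(a : ℚ) + 1, (b : ℚ), (ι : ℚ)], ![(a : ℚ), (b : ℚ) + 1, (ι : ℚ)],
    ![(a : ℚ) + 1, (b : ℚ) + 1, (ι : ℚ)]} with hS
  have hconv := convex_convexHull ℚ S
  have hsub {v : Fin 3 → ℚ} (hv : v ∈ S) : v ∈ convexHull ℚ S := subset_convexHull ℚ S hv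
  have hbottom := hconv (hsub (v := ![(a : ℚ), b, ι]) (by simp [hS]))
    (hsub (v := ![(a : ℚ) + 1, b, ι]) (by simp [hS])) (sub_nonneg.2 hx1) hx0 (by ring)
  have htop := hconv (hsub (v := ![(a : ℚ), (b : ℚ) + 1, ι]) (by simp [hS]))
    (hsub (v := ![(a : ℚ) + 1, (b : ℚ) + 1, ι]) (by simp [hS])) (sub_nonneg.2 hx1) hx0 (by ring)
  have hbase := hconv hbottom htop (sub_nonneg.2 hy1) hy0 (by ring)
  have hpoint := hconv (hsub (v := ![0, 0, 0]) (by simp [hS])) hbase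
    (a := 1 / (ι : ℚ)) (b := ((ι : ℚ) - 1) / ι) (by positivity) (by positivity)
    (by field_simp; ring)
  convert hpoint using 1
  rw [hx, hy]
  ext i
  fin_cases i <;> simp [-mul_eq_mul_left_iff] <;> field_simp <;> ring
end
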